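/- arXiv:1802.05692 — 9 statements merged into one kernel-verified Lean document; each statement's English description precedes it below -/
import Mathlib

section
/- Let M > 0, D(r) = 1 − 2M/r, and A(r) = −D(r)·D′(r)/(4r) = −(M/(2r³))·D(r). Let Ω ⊆ ℝ² be open, let r : Ω → (2M, ∞) be differentiable with ∂_u r = −D(r)/2, and let φ : Ω → ℝ satisfy ∂_u ∂_v φ = A(r)·φ, with ∂_v φ differentiable in u. Then on Ω: D(r)·φ = −(2/M)·∂_u (r³ ∂_v φ) − (3/M)·D(r)·r² ∂_v φ. -/
open Filter Set

/-- Exact Schwarzschild form of equation (eq:phi):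
`D(r) φ = −(2/M) ∂_u (r³ ∂_v φ) − (3/M) D(r) r² ∂_v φ` on `Ω`. -/
theorem schwarzschild_Dphi_identity
    (M : ℝ) (hM : 0 < M)
    (D A : ℝ → ℝ)
    (hD : ∀ ρ : ℝ, D ρ = 1 - 2 * M / ρ)
    (hA : ∀ ρ : ℝ, A ρ = -(M / (2 * ρ ^ 3)) * D ρ)
    (Ω : Set (ℝ × ℝ)) (hΩ : IsOpen Ω)
    (r φ φv : ℝ × ℝ → ℝ)
    (hr : ∀ p ∈ Ω, 2 * M < r p)
    (hru : ∀ p ∈ Ω, HasDerivAt (fun u => r (u, p.2)) (-(D (r p)) / 2) p.1)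
    (hφv : ∀ p ∈ Ω, HasDerivAt (fun v => φ (p.1, v)) (φv p) p.2)
    (hwave : ∀ p ∈ Ω, HasDerivAt (fun u => φv (u, p.2)) (A (r p) * φ p) p.1) :
    ∀ p ∈ Ω, D (r p) * φ p =
      -(2 / M) * deriv (fun u => (r (u, p.2)) ^ 3 * φv (u, p.2)) p.1
        - (3 / M) * D (r p) * (r p) ^ 2 * φv p := by
  intro p hp
  have hM' : M ≠ 0 := hM.ne'
  have hr' : r p ≠ 0 := by linarith [hr p hp]
  have hderiv := (((hru p hp).fun_pow 3).fun_mul (hwave p hp)).deriv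
  rw [hderiv, hA]
  simp only [Prod.mk.eta]
  field_simp
  ring
end

section
/- Let M > 0, D(r) = 1 − 2M/r, A(r) = −(M/(2r³))·D(r). Let Ω ⊆ ℝ² be open, r : Ω → (2M, ∞) C¹ with ∂_u r = −D(r)/2 and ∂_v r = D(r)/2, and let φ : Ω → ℝ be C² with ∂_u ∂_v φ = A(r)·φ. Set ψ = φ/r. Then for any u₁ < u₂ and v with [u₁,u₂] × {v} ⊆ Ω: ∫_{u₁}^{u₂} r² ∂_u ψ (u,v) du = [ r²ψ − (2/M)·r³ ∂_v φ ]_{u=u₁}^{u=u₂} − (3/M) ∫_{u₁}^{u₂} D(r)·r² ∂_v φ (u,v) du. -/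
open Filter Set

/-- Radiation flux identity along an ingoing null segment:
`∫_{u₁}^{u₂} r² ∂_u ψ du = [r²ψ − (2/M) r³ ∂_v φ]_{u₁}^{u₂}
  − (3/M) ∫_{u₁}^{u₂} D(r) r² ∂_v φ du`, where `ψ = φ/r`. -/
theorem radiation_flux_identity
    (M : ℝ) (hM : 0 < M)
    (D A : ℝ → ℝ)
    (hD : ∀ ρ : ℝ, D ρ = 1 - 2 * M / ρ)
    (hA : ∀ ρ : ℝ, A ρ = -(M / (2 * ρ ^ 3)) * D ρ)
    (Ω : Set (ℝ × ℝ)) (hΩ : IsOpen Ω)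
    (r φ : ℝ × ℝ → ℝ)
    (hr : ∀ p ∈ Ω, 2 * M < r p)
    (hrC1 : ContDiffOn ℝ 1 r Ω)
    (hru : ∀ p ∈ Ω, HasDerivAt (fun u => r (u, p.2)) (-(D (r p)) / 2) p.1)
    (hrv : ∀ p ∈ Ω, HasDerivAt (fun v => r (p.1, v)) (D (r p) / 2) p.2)
    (hφC2 : ContDiffOn ℝ 2 φ Ω)
    (hwave : ∀ p ∈ Ω, HasDerivAt (fun u => deriv (fun v => φ (u, v)) p.2)
      (A (r p) * φ p) p.1)
    (ψ : ℝ × ℝ → ℝ) (hψ : ψ = fun p => φ p / r p)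
    (u₁ u₂ v : ℝ) (hu : u₁ < u₂)
    (hseg : ∀ u ∈ Set.Icc u₁ u₂, ((u, v) : ℝ × ℝ) ∈ Ω) :
    ∫ u in u₁..u₂, (r (u, v)) ^ 2 * deriv (fun u' => ψ (u', v)) u =
      ((r (u₂, v)) ^ 2 * ψ (u₂, v) - (2 / M) * (r (u₂, v)) ^ 3 * deriv (fun v' => φ (u₂, v')) v)
      - ((r (u₁, v)) ^ 2 * ψ (u₁, v) - (2 / M) * (r (u₁, v)) ^ 3 * deriv (fun v' => φ (u₁, v')) v)
      - (3 / M) * ∫ u in u₁..u₂, D (r (u, v)) * (r (u, v)) ^ 2 * deriv (fun v' => φ (u, v')) v := by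
  have hS : IsOpen {u : ℝ | ((u, v) : ℝ × ℝ) ∈ Ω} := hΩ.preimage (by fun_prop)
  have hφS : ContDiffOn ℝ 2 (fun u => φ (u, v)) {u : ℝ | ((u, v) : ℝ × ℝ) ∈ Ω} :=
    hφC2.comp (by fun_prop) fun _ hx => hx
  have hφu : ContinuousOn (deriv fun u => φ (u, v)) (Icc u₁ u₂) :=
    (hφS.continuousOn_deriv_of_isOpen hS (by norm_num)).mono hseg
  have hφd : ∀ u ∈ Icc u₁ u₂,
      HasDerivAt (fun u' => φ (u', v)) (deriv (fun u' => φ (u', v)) u) u := fun u hx =>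
    ((hφS.differentiableOn (by norm_num)).differentiableAt
      (hS.mem_nhds (hseg u hx))).hasDerivAt
  have hrd : ∀ u ∈ Icc u₁ u₂,
      HasDerivAt (fun u' => r (u', v)) (-(D (r (u, v))) / 2) u := fun u hx =>
    hru (u, v) (hseg u hx)
  have hwd : ∀ u ∈ Icc u₁ u₂, HasDerivAt (fun u' => deriv (fun v' => φ (u', v')) v)
      (A (r (u, v)) * φ (u, v)) u := fun u hx => hwave (u, v) (hseg u hx)
  have hr0 : ∀ u ∈ Icc u₁ u₂, r (u, v) ≠ 0 := fun u hx =>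
    (lt_trans (by positivity) (hr _ (hseg u hx))).ne'
  have hrc : ContinuousOn (fun u => r (u, v)) (Icc u₁ u₂) := fun u hx =>
    (hrd u hx).continuousAt.continuousWithinAt
  have hφc : ContinuousOn (fun u => φ (u, v)) (Icc u₁ u₂) := fun u hx =>
    (hφd u hx).continuousAt.continuousWithinAt
  have hwc : ContinuousOn (fun u => deriv (fun v' => φ (u, v')) v) (Icc u₁ u₂) := fun u hx =>
    (hwd u hx).continuousAt.continuousWithinAt
  have hDc : ContinuousOn (fun u => D (r (u, v))) (Icc u₁ u₂) := by
    simp only [hD]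
    exact continuousOn_const.sub (continuousOn_const.div hrc hr0)
  have hψd : ∀ u ∈ Icc u₁ u₂, HasDerivAt (fun u' => ψ (u', v))
      ((deriv (fun u' => φ (u', v)) u * r (u, v) - φ (u, v) * (-(D (r (u, v))) / 2))
        / r (u, v) ^ 2) u := by
    intro u hx
    rw [hψ]
    exact (hφd u hx).div (hrd u hx) (hr0 u hx)
  have hI₁ : IntervalIntegrable (fun u => r (u, v) ^ 2 * deriv (fun u' => ψ (u', v)) u)
      MeasureTheory.volume u₁ u₂ := by
    refine ContinuousOn.intervalIntegrable_of_Icc hu.le ?_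
    have hc : ContinuousOn (fun u => deriv (fun u' => φ (u', v)) u * r (u, v)
        - φ (u, v) * (-(D (r (u, v))) / 2)) (Icc u₁ u₂) :=
      (hφu.mul hrc).sub (hφc.mul (hDc.neg.div_const 2))
    refine hc.congr fun u hx => ?_
    simp only [(hψd u hx).deriv]
    field_simp [hr0 u hx]
  have hI₂ : IntervalIntegrable
      (fun u => D (r (u, v)) * r (u, v) ^ 2 * deriv (fun v' => φ (u, v')) v)
      MeasureTheory.volume u₁ u₂ :=
    ContinuousOn.intervalIntegrable_of_Icc hu.le ((hDc.mul (hrc.pow 2)).mul hwc)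
  have hFTC := intervalIntegral.integral_eq_sub_of_hasDerivAt
    (f := fun u => r (u, v) ^ 2 * ψ (u, v)
      - (2 / M) * r (u, v) ^ 3 * deriv (fun v' => φ (u, v')) v)
    (f' := fun u => r (u, v) ^ 2 * deriv (fun u' => ψ (u', v)) u
      + (3 / M) * (D (r (u, v)) * r (u, v) ^ 2 * deriv (fun v' => φ (u, v')) v))
    (a := u₁) (b := u₂) ?_ (hI₁.add (hI₂.const_mul _))
  · rw [intervalIntegral.integral_add hI₁ (hI₂.const_mul _),
      intervalIntegral.integral_const_mul] at hFTC
    linarith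
  · intro u hx
    rw [uIcc_of_le hu.le] at hx
    have hρ := hr0 u hx
    refine HasDerivAt.congr_deriv ((((hrd u hx).pow 2).mul (hψd u hx)).sub
      ((((hrd u hx).pow 3).const_mul (2 / M)).mul (hwd u hx))) ?_
    rw [(hψd u hx).deriv, hA, hψ]
    simp only [Pi.pow_apply]
    field_simp
    ring
end

section
/- Under the hypotheses of the divergence identity — D : (0,∞) → ℝ C¹, r C² with ∂_v r = D(r)/2, ∂_u r = −D(r)/2, φ C² with ∂_u ∂_v φ = −(D(r)D′(r)/(4r))·φ, ψ = φ/r — assume these hold on a closed rectangle [u₁,u₂] × [v₁,v₂]. Then ∫_{v₁}^{v₂} ( r²∂_v ψ(u₂,v) − r²∂_v ψ(u₁,v) ) dv + ∫_{u₁}^{u₂} ( r²∂_u ψ(u,v₂) − r²∂_u ψ(u,v₁) ) du = 0. -/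
open Filter Set

section CharacteristicRectangle

variable {a b c d : ℝ} {f g r φ : ℝ × ℝ → ℝ} {p : ℝ × ℝ}

lemma uniqueDiffOn_Icc_prod_Icc (hab : a < b) (hcd : c < d) :
    UniqueDiffOn ℝ (Icc a b ×ˢ Icc c d) :=
  (uniqueDiffOn_Icc hab).prod (uniqueDiffOn_Icc hcd)

lemma closure_interior_Icc_prod_Icc (hab : a < b) (hcd : c < d) :
    closure (interior (Icc a b ×ˢ Icc c d)) = Icc a b ×ˢ Icc c d := by
  rw [interior_prod_eq, interior_Icc, interior_Icc, closure_prod_eq, closure_Ioo hab.ne,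
    closure_Ioo hcd.ne]

lemma HasFDerivWithinAt.hasDerivWithinAt_fst_slice {L : ℝ × ℝ →L[ℝ] ℝ}
    (hf : HasFDerivWithinAt f L (Icc a b ×ˢ Icc c d) p) (hp : p ∈ Icc a b ×ˢ Icc c d) :
    HasDerivWithinAt (fun x => f (x, p.2)) (L (1, 0)) (Icc a b) p.1 :=
  HasFDerivWithinAt.comp_hasDerivWithinAt (f := fun x => (x, p.2)) p.1 hf
    ((hasDerivWithinAt_id _ _).prodMk (hasDerivWithinAt_const _ _ _)) fun _ hx => ⟨hx, hp.2⟩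

lemma HasFDerivWithinAt.hasDerivWithinAt_snd_slice {L : ℝ × ℝ →L[ℝ] ℝ}
    (hf : HasFDerivWithinAt f L (Icc a b ×ˢ Icc c d) p) (hp : p ∈ Icc a b ×ˢ Icc c d) :
    HasDerivWithinAt (fun y => f (p.1, y)) (L (0, 1)) (Icc c d) p.2 :=
  HasFDerivWithinAt.comp_hasDerivWithinAt (f := fun y => (p.1, y)) p.2 hf
    ((hasDerivWithinAt_const _ _ _).prodMk (hasDerivWithinAt_id _ _)) fun _ hy => ⟨hp.1, hy⟩

lemma fderivWithin_fst_eq_of_hasDerivWithinAt {f' : ℝ} (hab : a < b)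
    (hf : DifferentiableWithinAt ℝ f (Icc a b ×ˢ Icc c d) p) (hp : p ∈ Icc a b ×ˢ Icc c d)
    (h : HasDerivWithinAt (fun x => f (x, p.2)) f' (Icc a b) p.1) :
    fderivWithin ℝ f (Icc a b ×ˢ Icc c d) p (1, 0) = f' :=
  (uniqueDiffOn_Icc hab p.1 hp.1).eq_deriv _
    (hf.hasFDerivWithinAt.hasDerivWithinAt_fst_slice hp) h

lemma fderivWithin_snd_eq_of_hasDerivWithinAt {f' : ℝ} (hcd : c < d)
    (hf : DifferentiableWithinAt ℝ f (Icc a b ×ˢ Icc c d) p) (hp : p ∈ Icc a b ×ˢ Icc c d)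
    (h : HasDerivWithinAt (fun y => f (p.1, y)) f' (Icc c d) p.2) :
    fderivWithin ℝ f (Icc a b ×ˢ Icc c d) p (0, 1) = f' :=
  (uniqueDiffOn_Icc hcd p.2 hp.2).eq_deriv _
    (hf.hasFDerivWithinAt.hasDerivWithinAt_snd_slice hp) h

lemma ContDiffOn.hasFDerivWithinAt_fderivWithin_Icc_prod_Icc (hab : a < b) (hcd : c < d)
    (hf : ContDiffOn ℝ 2 f (Icc a b ×ˢ Icc c d)) (hp : p ∈ Icc a b ×ˢ Icc c d) :
    HasFDerivWithinAt (fderivWithin ℝ f (Icc a b ×ˢ Icc c d))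
      (fderivWithin ℝ (fderivWithin ℝ f (Icc a b ×ˢ Icc c d)) (Icc a b ×ˢ Icc c d) p)
      (Icc a b ×ˢ Icc c d) p :=
  ((hf.fderivWithin (m := 1) (uniqueDiffOn_Icc_prod_Icc hab hcd) (by norm_num)).differentiableOn
    one_ne_zero p hp).hasFDerivWithinAt

/-- The second derivative of a `C²` function on a rectangle, evaluated on the coordinate
directions, is the iterated partial derivative. -/
lemma fderivWithin_fderivWithin_fst_snd_eq {m : ℝ} (hab : a < b) (hcd : c < d)
    (hf : ContDiffOn ℝ 2 f (Icc a b ×ˢ Icc c d))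
    (hg : ∀ q ∈ Icc a b ×ˢ Icc c d,
      HasDerivWithinAt (fun y => f (q.1, y)) (g q) (Icc c d) q.2)
    (hp : p ∈ Icc a b ×ˢ Icc c d)
    (hm : HasDerivWithinAt (fun x => g (x, p.2)) m (Icc a b) p.1) :
    fderivWithin ℝ (fderivWithin ℝ f (Icc a b ×ˢ Icc c d)) (Icc a b ×ˢ Icc c d) p (1, 0) (0, 1)
      = m := by
  have hfg : ∀ q ∈ Icc a b ×ˢ Icc c d,
      fderivWithin ℝ f (Icc a b ×ˢ Icc c d) q (0, 1) = g q := fun q hq =>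
    fderivWithin_snd_eq_of_hasDerivWithinAt hcd (hf.differentiableOn two_ne_zero q hq) hq (hg q hq)
  have h := (hf.hasFDerivWithinAt_fderivWithin_Icc_prod_Icc hab hcd hp).clm_apply
    (hasFDerivWithinAt_const ((0 : ℝ), (1 : ℝ)) p _)
  have h' := h.hasDerivWithinAt_fst_slice hp
  refine (uniqueDiffOn_Icc hab p.1 hp.1).eq_deriv _ ?_
    (hm.congr (fun x hx => hfg (x, p.2) ⟨hx, hp.2⟩) (hfg p hp))
  simpa using h'

/-- **Green's second identity** on a rectangle in null coordinates: the Wronskian flux of two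
`C²` functions whose potentials coincide has vanishing total boundary integral. -/
lemma integral_wronskian_flux_eq_zero (hab : a < b) (hcd : c < d)
    (hr : ContDiffOn ℝ 2 r (Icc a b ×ˢ Icc c d)) (hφ : ContDiffOn ℝ 2 φ (Icc a b ×ˢ Icc c d))
    (h : ∀ p ∈ Icc a b ×ˢ Icc c d,
      r p * fderivWithin ℝ (fderivWithin ℝ φ (Icc a b ×ˢ Icc c d)) (Icc a b ×ˢ Icc c d) p
          (1, 0) (0, 1) =
        fderivWithin ℝ (fderivWithin ℝ r (Icc a b ×ˢ Icc c d)) (Icc a b ×ˢ Icc c d) p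
          (1, 0) (0, 1) * φ p)
    {F G : ℝ × ℝ → ℝ}
    (hF : ∀ p ∈ Icc a b ×ˢ Icc c d, F p = r p * fderivWithin ℝ φ (Icc a b ×ˢ Icc c d) p (0, 1) -
      fderivWithin ℝ r (Icc a b ×ˢ Icc c d) p (0, 1) * φ p)
    (hG : ∀ p ∈ Icc a b ×ˢ Icc c d, G p = r p * fderivWithin ℝ φ (Icc a b ×ˢ Icc c d) p (1, 0) -
      fderivWithin ℝ r (Icc a b ×ˢ Icc c d) p (1, 0) * φ p) :
    (∫ y in c..d, (F (b, y) - F (a, y))) + (∫ x in a..b, (G (x, d) - G (x, c))) = 0 := by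
  set K := Icc a b ×ˢ Icc c d with hK
  have hflux : ∀ (w : ℝ × ℝ) (H : ℝ × ℝ → ℝ),
      (∀ p ∈ K, H p = r p * fderivWithin ℝ φ K p w - fderivWithin ℝ r K p w * φ p) → ∀ p ∈ K,
      ∃ L : ℝ × ℝ →L[ℝ] ℝ, HasFDerivWithinAt H L K p ∧ ∀ v, L v =
        r p * fderivWithin ℝ (fderivWithin ℝ φ K) K p v w
        + fderivWithin ℝ r K p v * fderivWithin ℝ φ K p w
        - (fderivWithin ℝ r K p w * fderivWithin ℝ φ K p v
        + fderivWithin ℝ (fderivWithin ℝ r K) K p v w * φ p) := by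
    intro w H hH p hp
    have hr1 := (hr.differentiableOn two_ne_zero p hp).hasFDerivWithinAt
    have hφ1 := (hφ.differentiableOn two_ne_zero p hp).hasFDerivWithinAt
    have hr2 := (hr.hasFDerivWithinAt_fderivWithin_Icc_prod_Icc hab hcd hp).clm_apply
      (hasFDerivWithinAt_const w p _)
    have hφ2 := (hφ.hasFDerivWithinAt_fderivWithin_Icc_prod_Icc hab hcd hp).clm_apply
      (hasFDerivWithinAt_const w p _)
    refine ⟨_, ((hr1.mul hφ2).sub (hr2.mul hφ1)).congr hH (hH p hp), fun v => ?_⟩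
    simp [← hK]
    ring
  have hFd := hflux (0, 1) F hF
  have hGd := hflux (1, 0) G hG
  have hFc : ContinuousOn F K := fun p hp => (hFd p hp).choose_spec.1.continuousWithinAt
  have hGc : ContinuousOn G K := fun p hp => (hGd p hp).choose_spec.1.continuousWithinAt
  have huniq : UniqueDiffOn ℝ K := uniqueDiffOn_Icc_prod_Icc hab hcd
  have hdiv : ∀ p ∈ K, fderivWithin ℝ F K p (1, 0) + fderivWithin ℝ G K p (0, 1) = 0 := by
    intro p hp
    obtain ⟨L, hL, hL'⟩ := hFd p hp
    obtain ⟨M, hM, hM'⟩ := hGd p hp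
    have hpc : p ∈ closure (interior K) := by rwa [hK, closure_interior_Icc_prod_Icc hab hcd]
    have hrs := (hr p hp).isSymmSndFDerivWithinAt (by simp) huniq hpc hp (0, 1) (1, 0)
    have hφs := (hφ p hp).isSymmSndFDerivWithinAt (by simp) huniq hpc hp (0, 1) (1, 0)
    rw [hL.fderivWithin (huniq p hp), hM.fderivWithin (huniq p hp), hL', hM', hrs, hφs]
    linear_combination 2 * h p hp
  have hnhds : ∀ x ∈ Ioo (min a b) (max a b) ×ˢ Ioo (min c d) (max c d) \ (∅ : Set (ℝ × ℝ)),
      K ∈ nhds x := by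
    rintro x ⟨hx, -⟩
    rw [min_eq_left hab.le, max_eq_right hab.le, min_eq_left hcd.le, max_eq_right hcd.le] at hx
    exact prod_mem_nhds (Icc_mem_nhds hx.1.1 hx.1.2) (Icc_mem_nhds hx.2.1 hx.2.2)
  have hKu : uIcc a b ×ˢ uIcc c d = K := by rw [uIcc_of_le hab.le, uIcc_of_le hcd.le]
  have hdivthm := MeasureTheory.integral2_divergence_prod_of_hasFDerivAt_off_countable F G
    (fderivWithin ℝ F K) (fderivWithin ℝ G K) a c b d ∅ countable_empty
    (hKu ▸ hFc) (hKu ▸ hGc)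
    (fun x hx => (hFd x (mem_of_mem_nhds (hnhds x hx))).choose_spec.1.differentiableWithinAt
      |>.hasFDerivWithinAt.hasFDerivAt (hnhds x hx))
    (fun x hx => (hGd x (mem_of_mem_nhds (hnhds x hx))).choose_spec.1.differentiableWithinAt
      |>.hasFDerivWithinAt.hasFDerivAt (hnhds x hx))
    (by
      rw [hKu]
      exact MeasureTheory.integrableOn_zero.congr_fun (fun x hx => (hdiv x hx).symm)
        (measurableSet_Icc.prod measurableSet_Icc))
  have hzero : ∫ x in a..b, ∫ y in c..d,
      (fderivWithin ℝ F K (x, y) (1, 0) + fderivWithin ℝ G K (x, y) (0, 1)) = 0 := by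
    refine intervalIntegral.integral_zero_ae (.of_forall fun x hx => ?_)
    refine intervalIntegral.integral_zero_ae (.of_forall fun y hy => ?_)
    rw [uIoc_of_le hab.le] at hx
    rw [uIoc_of_le hcd.le] at hy
    exact hdiv (x, y) ⟨Ioc_subset_Icc_self hx, Ioc_subset_Icc_self hy⟩
  have hFi : ∀ x ∈ Icc a b, IntervalIntegrable (fun y => F (x, y)) MeasureTheory.volume c d :=
    fun x hx => (hFc.comp (f := fun y => (x, y)) (by fun_prop)
      fun y hy => ⟨hx, hy⟩).intervalIntegrable_of_Icc hcd.le
  have hGi : ∀ y ∈ Icc c d, IntervalIntegrable (fun x => G (x, y)) MeasureTheory.volume a b :=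
    fun y hy => (hGc.comp (f := fun x => (x, y)) (by fun_prop)
      fun x hx => ⟨hx, hy⟩).intervalIntegrable_of_Icc hab.le
  rw [intervalIntegral.integral_sub (hFi b (right_mem_Icc.2 hab.le))
      (hFi a (left_mem_Icc.2 hab.le)),
    intervalIntegral.integral_sub (hGi d (right_mem_Icc.2 hcd.le)) (hGi c (left_mem_Icc.2 hcd.le))]
  linarith

end CharacteristicRectangle

/-- Green's identity on a characteristic rectangle: under the
hypotheses of the divergence identity, the sum of the boundary flux integrals
vanishes:
`∫_{v₁}^{v₂} (r²∂_vψ(u₂,·) − r²∂_vψ(u₁,·)) + ∫_{u₁}^{u₂} (r²∂_uψ(·,v₂) − r²∂_uψ(·,v₁)) = 0`. -/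
theorem greens_identity_characteristic_rectangle
    (D : ℝ → ℝ) (hDC1 : ContDiff ℝ 1 D)
    (u₁ u₂ v₁ v₂ : ℝ) (hu : u₁ < u₂) (hv : v₁ < v₂)
    (K : Set (ℝ × ℝ)) (hK : K = Set.Icc u₁ u₂ ×ˢ Set.Icc v₁ v₂)
    (r φ φv ψu ψv : ℝ × ℝ → ℝ)
    (hrpos : ∀ p ∈ K, 0 < r p)
    (hrC2 : ContDiffOn ℝ 2 r K)
    (hrv : ∀ p ∈ K, HasDerivWithinAt (fun v => r (p.1, v)) (D (r p) / 2) (Set.Icc v₁ v₂) p.2)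
    (hru : ∀ p ∈ K, HasDerivWithinAt (fun u => r (u, p.2)) (-(D (r p)) / 2) (Set.Icc u₁ u₂) p.1)
    (hφC2 : ContDiffOn ℝ 2 φ K)
    (hφv : ∀ p ∈ K, HasDerivWithinAt (fun v => φ (p.1, v)) (φv p) (Set.Icc v₁ v₂) p.2)
    (hwave : ∀ p ∈ K, HasDerivWithinAt (fun u => φv (u, p.2))
      (-(D (r p) * deriv D (r p) / (4 * r p)) * φ p) (Set.Icc u₁ u₂) p.1)
    (ψ : ℝ × ℝ → ℝ) (hψ : ψ = fun p => φ p / r p)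
    (hψu : ∀ p ∈ K, HasDerivWithinAt (fun u => ψ (u, p.2)) (ψu p) (Set.Icc u₁ u₂) p.1)
    (hψv : ∀ p ∈ K, HasDerivWithinAt (fun v => ψ (p.1, v)) (ψv p) (Set.Icc v₁ v₂) p.2)
    (hψucont : ContinuousOn ψu K) (hψvcont : ContinuousOn ψv K) :
    (∫ v in v₁..v₂, ((r (u₂, v)) ^ 2 * ψv (u₂, v) - (r (u₁, v)) ^ 2 * ψv (u₁, v)))
      + (∫ u in u₁..u₂, ((r (u, v₂)) ^ 2 * ψu (u, v₂) - (r (u, v₁)) ^ 2 * ψu (u, v₁))) = 0 := by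
  subst hK hψ
  have hφd := hφC2.differentiableOn two_ne_zero
  have hrd := hrC2.differentiableOn two_ne_zero
  refine integral_wronskian_flux_eq_zero hu hv hrC2 hφC2 (fun p hp => ?_)
    (F := fun p => r p ^ 2 * ψv p) (G := fun p => r p ^ 2 * ψu p)
    (fun p hp => ?_) (fun p hp => ?_)
  · have hr0 := (hrpos p hp).ne'
    have hrvu : HasDerivWithinAt (fun u => D (r (u, p.2)) / 2)
        (deriv D (r p) * (-(D (r p)) / 2) / 2) (Icc u₁ u₂) p.1 :=
      ((hDC1.differentiable one_ne_zero (r p)).hasDerivAt.comp_hasDerivWithinAt p.1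
        (hru p hp)).div_const 2
    rw [fderivWithin_fderivWithin_fst_snd_eq hu hv hφC2 hφv hp (hwave p hp),
      fderivWithin_fderivWithin_fst_snd_eq (g := fun p => D (r p) / 2) hu hv hrC2 hrv hp hrvu]
    field_simp
    ring
  · have hr0 := (hrpos p hp).ne'
    have hquot := ((hφd p hp).hasFDerivWithinAt.hasDerivWithinAt_snd_slice hp).div
      ((hrd p hp).hasFDerivWithinAt.hasDerivWithinAt_snd_slice hp) hr0
    rw [(uniqueDiffOn_Icc hv p.2 hp.2).eq_deriv _ (hψv p hp) hquot]
    field_simp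
  · have hr0 := (hrpos p hp).ne'
    have hquot := ((hφd p hp).hasFDerivWithinAt.hasDerivWithinAt_fst_slice hp).div
      ((hrd p hp).hasFDerivWithinAt.hasDerivWithinAt_fst_slice hp) hr0
    rw [(uniqueDiffOn_Icc hu p.1 hp.1).eq_deriv _ (hψu p hp) hquot]
    field_simp
end

section
/- Let M > 0, D(r) = 1 − 2M/r, A(r) = −(M/(2r³))·D(r), u₁ < u₂, v* ∈ ℝ, and let r be the Schwarzschild area-radius function on the strip S = [u₁,u₂] × [v*, ∞) (C¹, values in (2M,∞), ∂_v r = D(r)/2, ∂_u r = −D(r)/2). Let φ : S → ℝ be C² with ∂_u ∂_v φ = A(r)·φ, and suppose sup_S |φ| < ∞ and sup_S r²·|∂_v φ| < ∞. Define g(u,v) = (2r²/D(r))·∂_v φ(u,v). Then g(u₂,v) − g(u₁,v) → 0 as v → ∞. In particular, if the limits I(uᵢ) = lim_{v→∞} g(uᵢ,v) exist for i = 1,2, then I(u₁) = I(u₂). -/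
open Filter Set

/-- A function on `[a, ∞)` whose derivative is `(1 - 2M/f)/2` and which stays above `2M`
dominates a linear function of positive slope. -/
lemma tendsto_atTop_of_deriv_eq_half_one_sub {M a : ℝ} (hM : 0 < M) {f : ℝ → ℝ}
    (hf : ∀ v ∈ Set.Ici a, 2 * M < f v)
    (hf' : ∀ v ∈ Set.Ici a, HasDerivWithinAt f ((1 - 2 * M / f v) / 2) (Set.Ici a) v) :
    Tendsto f atTop atTop := by
  have hcont : ContinuousOn f (Set.Ici a) := fun v hv => (hf' v hv).continuousWithinAt
  have hmono : MonotoneOn f (Set.Ici a) := by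
    refine monotoneOn_of_hasDerivWithinAt_nonneg (convex_Ici a) hcont
      (fun v hv => (hf' v (interior_subset hv)).mono interior_subset) fun v hv => ?_
    have h := hf v (interior_subset hv)
    have : 2 * M / f v ≤ 1 := (div_le_one (by linarith)).2 h.le
    linarith
  have ha := hf a Set.self_mem_Ici
  set d := (1 - 2 * M / f a) / 2 with hd
  have hdpos : 0 < d := by
    have : 2 * M / f a < 1 := (div_lt_one (by linarith)).2 ha
    linarith
  have hlin : MonotoneOn (fun v => f v - d * v) (Set.Ici a) := by
    refine monotoneOn_of_hasDerivWithinAt_nonneg (convex_Ici a) (by fun_prop)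
      (fun v hv => ((hf' v (interior_subset hv)).sub
        ((hasDerivWithinAt_id v _).const_mul d)).mono interior_subset) fun v hv => ?_
    have hle := hmono Set.self_mem_Ici (interior_subset hv) (interior_subset hv)
    have : 2 * M / f v ≤ 2 * M / f a :=
      div_le_div_of_nonneg_left (by positivity) (by linarith) hle
    linarith
  refine tendsto_atTop_mono' atTop (f₁ := fun v => f a - d * a + d * v) ?_
    (tendsto_atTop_add_const_left _ _ (tendsto_id.const_mul_atTop hdpos))
  filter_upwards [eventually_ge_atTop a] with v hv
  have := hlin Set.self_mem_Ici hv hv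
  dsimp only at this
  linarith

/-- The derivative of `(2r²/D) ψ` when `r' = -D/2` and `ψ' = -(M/(2r³)) D φ`,
where `D = 1 - 2M/r`. -/
lemma hasDerivWithinAt_two_mul_sq_div_mul {M u φ : ℝ} (hM : 0 < M) {s : Set ℝ} {r ψ : ℝ → ℝ}
    (hr : 2 * M < r u)
    (hr' : HasDerivWithinAt r (-(1 - 2 * M / r u) / 2) s u)
    (hψ' : HasDerivWithinAt ψ (-(M / (2 * r u ^ 3)) * (1 - 2 * M / r u) * φ) s u) :
    HasDerivWithinAt (fun x => 2 * r x ^ 2 / (1 - 2 * M / r x) * ψ x)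
      ((-2 * r u + 2 * M / (1 - 2 * M / r u)) * ψ u - M / r u * φ) s u := by
  have hr0 : r u ≠ 0 := by linarith
  have hsub : r u - 2 * M ≠ 0 := by linarith
  have hD0 : 1 - 2 * M / r u ≠ 0 := by
    rw [one_sub_div hr0]
    exact div_ne_zero hsub hr0
  have hD' := ((hasDerivWithinAt_const u s (2 * M)).div hr' hr0).const_sub 1
  refine ((((hr'.pow 2).const_mul 2).div hD' hD0).mul hψ').congr_deriv ?_
  simp only [Pi.pow_apply, Pi.div_apply]
  field_simp
  ring

/-- Bound for the derivative of `(2r²/D) ψ` in the region `4M ≤ r`. -/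
lemma abs_transport_le {M ρ ψ φ C : ℝ} (hM : 0 < M) (hρ : 4 * M ≤ ρ)
    (hφ : |φ| ≤ C) (hψ : ρ ^ 2 * |ψ| ≤ C) :
    |(-2 * ρ + 2 * M / (1 - 2 * M / ρ)) * ψ - M / ρ * φ| ≤ (2 + M) * C / ρ := by
  have hρ0 : 0 < ρ := by linarith
  have hhalf : 2 * M / ρ ≤ 1 / 2 := by
    rw [div_le_iff₀ hρ0]
    linarith
  have hD0 : 0 < 1 - 2 * M / ρ := by linarith
  have hq0 : 0 ≤ 2 * M / (1 - 2 * M / ρ) := by positivity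
  have hq : 2 * M / (1 - 2 * M / ρ) ≤ ρ := by
    rw [div_le_iff₀ hD0]
    nlinarith
  have hcoef : |-2 * ρ + 2 * M / (1 - 2 * M / ρ)| ≤ 2 * ρ := by
    rw [abs_le]
    constructor <;> linarith
  calc |(-2 * ρ + 2 * M / (1 - 2 * M / ρ)) * ψ - M / ρ * φ|
      ≤ |-2 * ρ + 2 * M / (1 - 2 * M / ρ)| * |ψ| + M / ρ * |φ| := by
        refine (abs_sub _ _).trans_eq ?_
        rw [abs_mul, abs_mul, abs_of_pos (div_pos hM hρ0)]
    _ ≤ 2 * ρ * |ψ| + M / ρ * C := by gcongr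
    _ = 2 * (ρ ^ 2 * |ψ|) / ρ + M / ρ * C := by field_simp
    _ ≤ 2 * C / ρ + M / ρ * C := by gcongr
    _ = (2 + M) * C / ρ := by ring

/-- Conservation of the Newman–Penrose constant along null
infinity (reduced form): with `g = (2r²/D(r)) ∂_v φ`,
`g(u₂,v) − g(u₁,v) → 0` as `v → ∞`; in particular the limits along distinct
outgoing null lines, when they exist, agree. -/
theorem newman_penrose_constant_conservation
    (M : ℝ) (hM : 0 < M)
    (D A : ℝ → ℝ)
    (hD : ∀ ρ : ℝ, D ρ = 1 - 2 * M / ρ)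
    (hA : ∀ ρ : ℝ, A ρ = -(M / (2 * ρ ^ 3)) * D ρ)
    (u₁ u₂ vs : ℝ) (hu : u₁ < u₂)
    (S : Set (ℝ × ℝ)) (hS : S = Set.Icc u₁ u₂ ×ˢ Set.Ici vs)
    (r φ φv : ℝ × ℝ → ℝ)
    (hrcont : ContinuousOn r S)
    (hr : ∀ p ∈ S, 2 * M < r p)
    (hru : ∀ p ∈ S, HasDerivWithinAt (fun u => r (u, p.2)) (-(D (r p)) / 2) (Set.Icc u₁ u₂) p.1)
    (hrv : ∀ p ∈ S, HasDerivWithinAt (fun v => r (p.1, v)) (D (r p) / 2) (Set.Ici vs) p.2)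
    (hφC2 : ContDiffOn ℝ 2 φ S)
    (hφcont : ContinuousOn φ S) (hφvcont : ContinuousOn φv S)
    (hφv : ∀ p ∈ S, HasDerivWithinAt (fun v => φ (p.1, v)) (φv p) (Set.Ici vs) p.2)
    (hwave : ∀ p ∈ S, HasDerivWithinAt (fun u => φv (u, p.2)) (A (r p) * φ p) (Set.Icc u₁ u₂) p.1)
    (C : ℝ) (hφbd : ∀ p ∈ S, |φ p| ≤ C) (hφvbd : ∀ p ∈ S, (r p) ^ 2 * |φv p| ≤ C)
    (g : ℝ × ℝ → ℝ) (hg : g = fun p => (2 * (r p) ^ 2 / D (r p)) * φv p) :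
    Tendsto (fun v => g (u₂, v) - g (u₁, v)) atTop (nhds 0) ∧
    (∀ I₁ I₂ : ℝ,
      Tendsto (fun v => g (u₁, v)) atTop (nhds I₁) →
      Tendsto (fun v => g (u₂, v)) atTop (nhds I₂) → I₁ = I₂) := by
  obtain rfl : D = fun ρ => 1 - 2 * M / ρ := funext hD
  obtain rfl : A = fun ρ => -(M / (2 * ρ ^ 3)) * (1 - 2 * M / ρ) := funext hA
  subst hS hg
  have hu₁ : u₁ ∈ Set.Icc u₁ u₂ := Set.left_mem_Icc.2 hu.le
  have hu₂ : u₂ ∈ Set.Icc u₁ u₂ := Set.right_mem_Icc.2 hu.le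
  have hrtop : Tendsto (fun v => r (u₂, v)) atTop atTop :=
    tendsto_atTop_of_deriv_eq_half_one_sub hM (fun v hv => hr (u₂, v) ⟨hu₂, hv⟩)
      fun v hv => hrv (u₂, v) ⟨hu₂, hv⟩
  have hC : 0 ≤ C := (abs_nonneg _).trans (hφbd (u₁, vs) ⟨hu₁, Set.self_mem_Ici⟩)
  have hanti : ∀ v ∈ Set.Ici vs, AntitoneOn (fun u => r (u, v)) (Set.Icc u₁ u₂) := by
    intro v hv
    refine antitoneOn_of_hasDerivWithinAt_nonpos (convex_Icc u₁ u₂)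
      (fun u hu => (hru (u, v) ⟨hu, hv⟩).continuousWithinAt)
      (fun u hu => (hru (u, v) ⟨interior_subset hu, hv⟩).mono interior_subset) fun u hu => ?_
    have h := hr (u, v) ⟨interior_subset hu, hv⟩
    have : 2 * M / r (u, v) ≤ 1 := (div_le_one (by linarith)).2 h.le
    dsimp only
    linarith
  have hlim : Tendsto (fun v => 2 * r (u₂, v) ^ 2 / (1 - 2 * M / r (u₂, v)) * φv (u₂, v)
      - 2 * r (u₁, v) ^ 2 / (1 - 2 * M / r (u₁, v)) * φv (u₁, v)) atTop (nhds 0) := by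
    have hbound : Tendsto (fun v => (2 + M) * C / r (u₂, v) * |u₂ - u₁|) atTop (nhds 0) := by
      simpa using (hrtop.const_div_atTop ((2 + M) * C)).mul_const |u₂ - u₁|
    refine squeeze_zero_norm' ?_ hbound
    filter_upwards [eventually_ge_atTop vs, hrtop.eventually_ge_atTop (4 * M)] with v hv h4
    refine (convex_Icc u₁ u₂).norm_image_sub_le_of_norm_hasDerivWithin_le
      (f := fun u => 2 * r (u, v) ^ 2 / (1 - 2 * M / r (u, v)) * φv (u, v))
      (fun u hu => hasDerivWithinAt_two_mul_sq_div_mul hM (hr (u, v) ⟨hu, hv⟩)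
        (hru (u, v) ⟨hu, hv⟩) (hwave (u, v) ⟨hu, hv⟩)) (fun u hu => ?_) hu₁ hu₂
    have hle : r (u₂, v) ≤ r (u, v) := hanti v hv hu hu₂ hu.2
    refine (abs_transport_le hM (h4.trans hle) (hφbd (u, v) ⟨hu, hv⟩)
      (hφvbd (u, v) ⟨hu, hv⟩)).trans ?_
    exact div_le_div_of_nonneg_left (by positivity) (by linarith) hle
  refine ⟨hlim, fun I₁ I₂ h₁ h₂ => ?_⟩
  have := tendsto_nhds_unique (h₂.sub h₁) hlim
  linarith
end

section
/- Let M > 0, D(r) = 1 − 2M/r, A(r) = −(M/(2r³))·D(r), u₁ < u₂, v* ∈ ℝ, let r be the Schwarzschild area-radius function on the strip S = [u₁,u₂] × [v*, ∞), and let φ : S → ℝ be C³ with ∂_u ∂_v φ = A(r)·φ, sup_S |φ| < ∞, and sup_S r²·|∂_v φ| < ∞. Fix u₀ ∈ (u₁,u₂) and set g(u,v) = (2r²/D(r))·∂_v φ(u,v) and Tφ = ∂_u φ + ∂_v φ. Suppose that g(u₀,v) converges as v → ∞ and that (2r²/D(r))·∂_v(Tφ)(u₀,v) converges as v → ∞.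 Then lim_{v→∞} (2r²/D(r))·∂_v(Tφ)(u₀,v) = 0. -/
open Filter Set

/-- If `f` and its derivative `f'` both converge at infinity, the limit of `f'` is zero. -/
theorem eq_zero_of_tendsto_of_tendsto_deriv {f f' : ℝ → ℝ} {a c L : ℝ}
    (hderiv : ∀ v, a < v → HasDerivAt f (f' v) v)
    (hf : Tendsto f atTop (nhds c)) (hf' : Tendsto f' atTop (nhds L)) : L = 0 := by
  have hmvt : ∀ v : ℝ, ∃ ξ, v < ξ ∧ (a < v → f' ξ = f (v + 1) - f v) := by
    intro v
    by_cases hv : a < v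
    · obtain ⟨ξ, hξ, h⟩ := exists_hasDerivAt_eq_slope f f' (lt_add_one v)
        (fun x hx => (hderiv x (hv.trans_le hx.1)).continuousAt.continuousWithinAt)
        (fun x hx => hderiv x (hv.trans hx.1))
      exact ⟨ξ, hξ.1, fun _ => by simpa using h⟩
    · exact ⟨v + 1, lt_add_one v, fun h => absurd h hv⟩
  choose ξ hξ hslope using hmvt
  have h1 : Tendsto (fun v => f' (ξ v)) atTop (nhds L) :=
    hf'.comp (tendsto_atTop_mono (fun v => (hξ v).le) tendsto_id)
  have h2 : Tendsto (fun v => f (v + 1) - f v) atTop (nhds 0) := by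
    simpa using (hf.comp (tendsto_atTop_add_const_right _ 1 tendsto_id)).sub hf
  refine tendsto_nhds_unique (h1.congr' ?_) h2
  filter_upwards [eventually_gt_atTop a] with v hv using hslope v hv

/-- The area radius tends to infinity along an outgoing null ray. -/
theorem tendsto_atTop_of_hasDerivWithinAt_area_radius {M vs : ℝ} (hM : 0 < M) {ρ : ℝ → ℝ}
    (hρ : ∀ v ∈ Ici vs, 2 * M < ρ v)
    (hderiv : ∀ v ∈ Ici vs, HasDerivWithinAt ρ ((1 - 2 * M / ρ v) / 2) (Ici vs) v) :
    Tendsto ρ atTop atTop := by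
  have hcont : ContinuousOn ρ (Ici vs) := fun v hv => (hderiv v hv).continuousWithinAt
  have hd : ∀ v ∈ interior (Ici vs), HasDerivAt ρ ((1 - 2 * M / ρ v) / 2) v := by
    intro v hv
    rw [interior_Ici] at hv
    exact (hderiv v (Ioi_subset_Ici_self hv)).hasDerivAt (Ici_mem_nhds hv)
  have hpos : ∀ v ∈ Ici vs, 0 < (1 - 2 * M / ρ v) / 2 := by
    intro v hv
    have h := hρ v hv
    have : 2 * M / ρ v < 1 := (div_lt_one (by linarith)).2 h
    linarith
  have hmono : MonotoneOn ρ (Ici vs) :=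
    monotoneOn_of_deriv_nonneg (convex_Ici vs) hcont
      (fun v hv => (hd v hv).differentiableAt.differentiableWithinAt)
      (fun v hv => by rw [(hd v hv).deriv]; exact (hpos v (interior_subset hv)).le)
  have hvs : vs ∈ Ici vs := self_mem_Ici
  have hlower : ∀ v ∈ Ici vs, (1 - 2 * M / ρ vs) / 2 * (v - vs) ≤ ρ v - ρ vs := by
    intro v hv
    refine (convex_Ici vs).mul_sub_le_image_sub_of_le_deriv hcont
      (fun v hv => (hd v hv).differentiableAt.differentiableWithinAt) ?_ vs hvs v hv hv
    intro x hx
    rw [(hd x hx).deriv]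
    have hx' := interior_subset hx
    have h0 := hρ vs hvs
    have : 2 * M / ρ x ≤ 2 * M / ρ vs :=
      div_le_div_of_nonneg_left (by linarith) (by linarith) (hmono hvs hx' hx')
    linarith
  have hlin : Tendsto (fun v => (1 - 2 * M / ρ vs) / 2 * (v - vs) + ρ vs) atTop atTop :=
    tendsto_atTop_add_const_right _ _
      ((tendsto_atTop_add_const_right _ (-vs) tendsto_id).const_mul_atTop (hpos vs hvs))
  refine tendsto_atTop_mono' _ ?_ hlin
  filter_upwards [eventually_ge_atTop vs] with v hv
  linarith [hlower v hv]

/-- Symmetry of mixed partial derivatives at a point near which `φ` is `C²` with partial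
derivatives `φu` and `φv`. -/
theorem hasDerivAt_mixed_partial {φ φu φv : ℝ × ℝ → ℝ} {p : ℝ × ℝ} {w : ℝ}
    (hφ : ContDiffAt ℝ 2 φ p)
    (hφu : ∀ᶠ q in nhds p, HasDerivAt (fun u => φ (u, q.2)) (φu q) q.1)
    (hφv : ∀ᶠ q in nhds p, HasDerivAt (fun v => φ (q.1, v)) (φv q) q.2)
    (hw : HasDerivAt (fun u => φv (u, p.2)) w p.1) :
    HasDerivAt (fun v => φu (p.1, v)) w p.2 := by
  have hdiff : ∀ᶠ q in nhds p, DifferentiableAt ℝ φ q :=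
    (hφ.eventually (by simp)).mono fun q hq => hq.differentiableAt (by norm_num)
  have hu : ∀ q : ℝ × ℝ, HasDerivAt (fun u => (u, q.2)) ((1, 0) : ℝ × ℝ) q.1 := fun q =>
    (hasDerivAt_id q.1).prodMk (hasDerivAt_const q.1 q.2)
  have hv : ∀ q : ℝ × ℝ, HasDerivAt (fun v => (q.1, v)) ((0, 1) : ℝ × ℝ) q.2 := fun q =>
    (hasDerivAt_const q.2 q.1).prodMk (hasDerivAt_id q.2)
  have eu : φu =ᶠ[nhds p] fun q => fderiv ℝ φ q (1, 0) := by
    filter_upwards [hdiff, hφu] with q hq hqu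
    exact hqu.unique (hq.hasFDerivAt.comp_hasDerivAt q.1 (hu q))
  have ev : φv =ᶠ[nhds p] fun q => fderiv ℝ φ q (0, 1) := by
    filter_upwards [hdiff, hφv] with q hq hqv
    exact hqv.unique (hq.hasFDerivAt.comp_hasDerivAt q.2 (hv q))
  have h2 : HasFDerivAt (fderiv ℝ φ) (fderiv ℝ (fderiv ℝ φ) p) p :=
    ((hφ.fderiv_right (m := 1) (by norm_num)).differentiableAt (by norm_num)).hasFDerivAt
  have hsymm : fderiv ℝ (fderiv ℝ φ) p (0, 1) (1, 0) = fderiv ℝ (fderiv ℝ φ) p (1, 0) (0, 1) :=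
    (hφ.isSymmSndFDerivAt (by simp)) _ _
  have hAu : HasDerivAt (fun u => φv (u, p.2)) (fderiv ℝ (fderiv ℝ φ) p (1, 0) (0, 1)) p.1 := by
    have h : HasDerivAt (fun t => fderiv ℝ φ (t, p.2) (0, 1))
        (fderiv ℝ (fderiv ℝ φ) p (1, 0) (0, 1)) p.1 :=
      (ContinuousLinearMap.apply ℝ ℝ ((0, 1) : ℝ × ℝ)).hasFDerivAt.comp_hasDerivAt p.1
        (h2.comp_hasDerivAt p.1 (hu p))
    exact h.congr_of_eventuallyEq ((hu p).continuousAt.eventually ev)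
  have hAv : HasDerivAt (fun v => φu (p.1, v)) (fderiv ℝ (fderiv ℝ φ) p (0, 1) (1, 0)) p.2 := by
    have h : HasDerivAt (fun t => fderiv ℝ φ (p.1, t) (1, 0))
        (fderiv ℝ (fderiv ℝ φ) p (0, 1) (1, 0)) p.2 :=
      (ContinuousLinearMap.apply ℝ ℝ ((1, 0) : ℝ × ℝ)).hasFDerivAt.comp_hasDerivAt p.2
        (h2.comp_hasDerivAt p.2 (hv p))
    exact h.congr_of_eventuallyEq ((hv p).continuousAt.eventually eu)
  rwa [hw.unique hAu, ← hsymm]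

/-- The Newman–Penrose constant of `Tφ = ∂_u φ + ∂_v φ` vanishes:
if `(2r²/D) ∂_v φ (u₀, ·)` converges as `v → ∞` and `(2r²/D) ∂_v(Tφ)(u₀, ·)`
converges to `L`, then `L = 0`. -/
theorem newman_penrose_constant_of_T_vanishes
    (M : ℝ) (hM : 0 < M)
    (D A : ℝ → ℝ)
    (hD : ∀ ρ : ℝ, D ρ = 1 - 2 * M / ρ)
    (hA : ∀ ρ : ℝ, A ρ = -(M / (2 * ρ ^ 3)) * D ρ)
    (u₁ u₂ vs : ℝ) (hu : u₁ < u₂)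
    (S : Set (ℝ × ℝ)) (hS : S = Set.Icc u₁ u₂ ×ˢ Set.Ici vs)
    (r φ φu φv : ℝ × ℝ → ℝ)
    (hrcont : ContinuousOn r S)
    (hr : ∀ p ∈ S, 2 * M < r p)
    (hru : ∀ p ∈ S, HasDerivWithinAt (fun u => r (u, p.2)) (-(D (r p)) / 2) (Set.Icc u₁ u₂) p.1)
    (hrv : ∀ p ∈ S, HasDerivWithinAt (fun v => r (p.1, v)) (D (r p) / 2) (Set.Ici vs) p.2)
    (hφC3 : ContDiffOn ℝ 3 φ S)
    (hφcont : ContinuousOn φ S) (hφucont : ContinuousOn φu S) (hφvcont : ContinuousOn φv S)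
    (hφu : ∀ p ∈ S, HasDerivWithinAt (fun u => φ (u, p.2)) (φu p) (Set.Icc u₁ u₂) p.1)
    (hφv : ∀ p ∈ S, HasDerivWithinAt (fun v => φ (p.1, v)) (φv p) (Set.Ici vs) p.2)
    (hwave : ∀ p ∈ S, HasDerivWithinAt (fun u => φv (u, p.2)) (A (r p) * φ p) (Set.Icc u₁ u₂) p.1)
    (C : ℝ) (hφbd : ∀ p ∈ S, |φ p| ≤ C) (hφvbd : ∀ p ∈ S, (r p) ^ 2 * |φv p| ≤ C)
    (u₀ : ℝ) (hu₀ : u₀ ∈ Set.Ioo u₁ u₂)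
    (Tφv : ℝ → ℝ)
    (hTφv : ∀ v ∈ Set.Ici vs,
      HasDerivWithinAt (fun t => φu (u₀, t) + φv (u₀, t)) (Tφv v) (Set.Ici vs) v)
    (c : ℝ)
    (hgconv : Tendsto (fun v => (2 * (r (u₀, v)) ^ 2 / D (r (u₀, v))) * φv (u₀, v))
      atTop (nhds c))
    (L : ℝ)
    (hTconv : Tendsto (fun v => (2 * (r (u₀, v)) ^ 2 / D (r (u₀, v))) * Tφv v)
      atTop (nhds L)) :
    L = 0 := by
  have hmem : ∀ v ∈ Ici vs, (u₀, v) ∈ S := fun v hv => by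
    rw [hS]; exact ⟨Ioo_subset_Icc_self hu₀, hv⟩
  have hnhds : ∀ q : ℝ × ℝ, q.1 ∈ Ioo u₁ u₂ → vs < q.2 → S ∈ nhds q := fun q h1 h2 => by
    rw [hS]; exact prod_mem_nhds (Icc_mem_nhds h1.1 h1.2) (Ici_mem_nhds h2)
  have hinner : ∀ v, vs < v → ∀ᶠ q : ℝ × ℝ in nhds (u₀, v), q.1 ∈ Ioo u₁ u₂ ∧ vs < q.2 :=
    fun v hv => prod_mem_nhds (Ioo_mem_nhds hu₀.1 hu₀.2) (Ioi_mem_nhds hv)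
  have hr_top : Tendsto (fun v => r (u₀, v)) atTop atTop := by
    refine tendsto_atTop_of_hasDerivWithinAt_area_radius hM (fun v hv => hr _ (hmem v hv)) ?_
    intro v hv
    rw [← hD]
    exact hrv _ (hmem v hv)
  have hφuv : ∀ v, vs < v →
      HasDerivAt (fun t => φu (u₀, t)) (A (r (u₀, v)) * φ (u₀, v)) v := by
    intro v hv
    refine hasDerivAt_mixed_partial (p := (u₀, v)) (φ := φ) (φv := φv)
      ((hφC3.contDiffAt (hnhds _ hu₀ hv)).of_le (by norm_num)) ?_ ?_
      ((hwave _ (hmem v hv.le)).hasDerivAt (Icc_mem_nhds hu₀.1 hu₀.2))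
    · filter_upwards [hinner v hv] with q hq
      exact (hφu q (mem_of_mem_nhds (hnhds q hq.1 hq.2))).hasDerivAt
        (Icc_mem_nhds hq.1.1 hq.1.2)
    · filter_upwards [hinner v hv] with q hq
      exact (hφv q (mem_of_mem_nhds (hnhds q hq.1 hq.2))).hasDerivAt (Ici_mem_nhds hq.2)
  have hφvv : ∀ v, vs < v →
      HasDerivAt (fun t => φv (u₀, t)) (Tφv v - A (r (u₀, v)) * φ (u₀, v)) v := by
    intro v hv
    simpa using ((hTφv v hv.le).hasDerivAt (Ici_mem_nhds hv)).fun_sub (hφuv v hv)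
  have hg : ∀ v, vs < v →
      HasDerivAt (fun v => (2 * (r (u₀, v)) ^ 2 / D (r (u₀, v))) * φv (u₀, v))
        ((2 * (r (u₀, v)) ^ 2 / D (r (u₀, v))) * Tφv v
          + (M * (r (u₀, v))⁻¹ * φ (u₀, v)
            + (2 * (r (u₀, v))⁻¹ - 2 * M * (r (u₀, v))⁻¹ ^ 2 / D (r (u₀, v)))
              * ((r (u₀, v)) ^ 2 * φv (u₀, v)))) v := by
    intro v hv
    have hrv' : HasDerivAt (fun v => r (u₀, v)) (D (r (u₀, v)) / 2) v :=
      (hrv _ (hmem v hv.le)).hasDerivAt (Ici_mem_nhds hv)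
    have hr' := hr _ (hmem v hv.le)
    have hr0 : r (u₀, v) ≠ 0 := by linarith
    have hr2 : r (u₀, v) - 2 * M ≠ 0 := by linarith
    have hDr : D (r (u₀, v)) = (r (u₀, v) - 2 * M) / r (u₀, v) := by
      rw [hD]; field_simp
    have hD0 : D (r (u₀, v)) ≠ 0 := by rw [hDr]; exact div_ne_zero hr2 hr0
    have hDd : HasDerivAt (fun v => D (r (u₀, v)))
        (2 * M / r (u₀, v) ^ 2 * (D (r (u₀, v)) / 2)) v := by
      simp only [hD (r (u₀, _))] at hrv' ⊢
      refine (((hasDerivAt_const v (2 * M)).fun_div hrv' hr0).const_sub 1).congr_deriv ?_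
      field_simp
      ring
    refine ((((hrv'.fun_pow 2).const_mul 2).fun_div hDd hD0).fun_mul (hφvv v hv)).congr_deriv ?_
    rw [hA, hDr]
    field_simp
    ring
  have hinv : Tendsto (fun v => (r (u₀, v))⁻¹) atTop (nhds 0) := hr_top.inv_tendsto_atTop
  have hDlim : Tendsto (fun v => D (r (u₀, v))) atTop (nhds 1) := by
    simp only [hD, div_eq_mul_inv]
    simpa using (hinv.const_mul (2 * M)).const_sub 1
  have herr1 : Tendsto (fun v => M * (r (u₀, v))⁻¹ * φ (u₀, v)) atTop (nhds 0) := by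
    refine Tendsto.zero_mul_isBoundedUnder_le (by simpa using hinv.const_mul M) ?_
    refine isBoundedUnder_of_eventually_le (a := C) ?_
    filter_upwards [eventually_ge_atTop vs] with v hv using hφbd _ (hmem v hv)
  have herr2 : Tendsto (fun v => (2 * (r (u₀, v))⁻¹ - 2 * M * (r (u₀, v))⁻¹ ^ 2 / D (r (u₀, v)))
      * ((r (u₀, v)) ^ 2 * φv (u₀, v))) atTop (nhds 0) := by
    refine Tendsto.zero_mul_isBoundedUnder_le ?_ ?_
    · simpa using (hinv.const_mul 2).sub
        (((hinv.pow 2).const_mul (2 * M)).div hDlim one_ne_zero)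
    · refine isBoundedUnder_of_eventually_le (a := C) ?_
      filter_upwards [eventually_ge_atTop vs] with v hv
      simpa [abs_mul] using hφvbd _ (hmem v hv)
  refine eq_zero_of_tendsto_of_tendsto_deriv hg hgconv ?_
  simpa using hTconv.add (herr1.add herr2)
end

section
/- Let M > 0, D(r) = 1 − 2M/r, v* ∈ ℝ, and let r : [v*, ∞) → (2M, ∞) solve r′(v) = D(r(v))/2. Let ψ : [v*, ∞) → ℝ be C¹, set φ = r·ψ, and suppose sup_{v ≥ v*} r(v)³·|φ′(v)| < ∞. Then the improper integral ∫_{v*}^{∞} 2·r(v)·φ′(v) dv converges absolutely, the limit lim_{V→∞} ( ∫_{v*}^{V} r(v)² ψ′(v) dv + r(V)² ψ(V) ) exists and is finite, and equals r(v*)² ψ(v*) + ∫_{v*}^{∞} 2·r(v)·φ′(v) dv. -/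
open Filter Set MeasureTheory

/-- The area radius is nondecreasing along an outgoing null line of the exterior. -/
theorem monotoneOn_areaRadius {M vs : ℝ} (hM : 0 < M) {r : ℝ → ℝ}
    (hr : ∀ v ∈ Ici vs, 2 * M < r v)
    (hrd : ∀ v ∈ Ici vs, HasDerivWithinAt r ((1 - 2 * M / r v) / 2) (Ici vs) v) :
    MonotoneOn r (Ici vs) := by
  refine monotoneOn_of_hasDerivWithinAt_nonneg (convex_Ici vs)
    (f' := fun v => (1 - 2 * M / r v) / 2)
    (fun v hv => (hrd v hv).continuousWithinAt)
    (fun v hv => (hrd v (interior_subset hv)).mono interior_subset) fun v hv => ?_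
  have h := hr v (interior_subset hv)
  have : 2 * M / r v ≤ 1 := (div_le_one (by linarith)).2 h.le
  linarith

/-- A continuous function that is `O(r⁻²)` is integrable along an outgoing null line. -/
theorem integrableOn_of_sq_areaRadius_mul_le {M vs : ℝ} (hM : 0 < M) {r : ℝ → ℝ}
    (hr : ∀ v ∈ Ici vs, 2 * M < r v)
    (hrd : ∀ v ∈ Ici vs, HasDerivWithinAt r ((1 - 2 * M / r v) / 2) (Ici vs) v)
    {f : ℝ → ℝ} (hf : ContinuousOn f (Ici vs)) {C : ℝ}
    (hC : ∀ v ∈ Ici vs, r v ^ 2 * |f v| ≤ C) : IntegrableOn f (Ioi vs) := by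
  have hpos : ∀ v ∈ Ici vs, 0 < r v := fun v hv => by linarith [hr v hv]
  have hmono := monotoneOn_areaRadius hM hr hrd
  have hrc : ContinuousOn r (Ici vs) := fun v hv => (hrd v hv).continuousWithinAt
  have hvs : vs ∈ Ici vs := self_mem_Ici
  have hC0 : 0 ≤ C := (by positivity : 0 ≤ r vs ^ 2 * |f vs|).trans (hC vs hvs)
  set δ := 1 - 2 * M / r vs with hδ
  have hδ0 : 0 < δ := sub_pos.2 ((div_lt_one (hpos vs hvs)).2 (hr vs hvs))
  set g' : ℝ → ℝ := fun v => 2 * C / δ * ((1 - 2 * M / r v) / 2 / r v ^ 2) with hg'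
  have hg'c : ContinuousOn g' (Ici vs) := by
    have h1 : ∀ v ∈ Ici vs, r v ≠ 0 := fun v hv => (hpos v hv).ne'
    have h2 : ∀ v ∈ Ici vs, r v ^ 2 ≠ 0 := fun v hv => pow_ne_zero 2 (h1 v hv)
    exact continuousOn_const.mul (((continuousOn_const.sub
      (continuousOn_const.div hrc h1)).div_const 2).div (hrc.pow 2) h2)
  have hle : ∀ v ∈ Ici vs, ‖f v‖ ≤ g' v := fun v hv => by
    have hrv := hpos v hv
    have hδv : δ ≤ 1 - 2 * M / r v :=
      sub_le_sub_left (div_le_div_of_nonneg_left (by positivity) (hpos vs hvs)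
        (hmono hvs hv hv)) 1
    have h1 : ‖f v‖ ≤ C / r v ^ 2 := by
      rw [le_div_iff₀ (by positivity), Real.norm_eq_abs, mul_comm]
      exact hC v hv
    refine h1.trans ?_
    have h2 : g' v = C / r v ^ 2 * ((1 - 2 * M / r v) / δ) := by
      simp only [hg']
      ring
    rw [h2]
    exact le_mul_of_one_le_right (by positivity) ((one_le_div hδ0).2 hδv)
  refine integrableOn_Ioi_of_intervalIntegral_norm_bounded (l := atTop) (b := id)
    (2 * C / δ * (r vs)⁻¹) vs
    (fun V => ((hf.mono Icc_subset_Ici_self).integrableOn_Icc).mono_set Ioc_subset_Icc_self)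
    tendsto_id ?_
  filter_upwards [eventually_ge_atTop vs] with V hV
  have hsub : uIcc vs V ⊆ Ici vs := by
    rw [uIcc_of_le hV]
    exact Icc_subset_Ici_self
  have hg'i : IntervalIntegrable g' volume vs V := (hg'c.mono hsub).intervalIntegrable
  have hFTC : ∫ v in vs..V, g' v
      = -(2 * C / δ * (r V)⁻¹) - -(2 * C / δ * (r vs)⁻¹) := by
    refine intervalIntegral.integral_eq_sub_of_hasDerivAt_of_le
      (f := fun v => -(2 * C / δ * (r v)⁻¹)) hV ?_ (fun v hv => ?_) hg'i
    · exact ((continuousOn_const.mul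
        (hrc.inv₀ fun v hv => (hpos v hv).ne')).neg).mono Icc_subset_Ici_self
    · have h := (hrd v hv.1.le).hasDerivAt (Ici_mem_nhds hv.1)
      refine ((h.inv (hpos v hv.1.le).ne').const_mul (2 * C / δ)).neg.congr_deriv ?_
      simp only [hg']
      ring
  calc ∫ v in vs..V, ‖f v‖ ≤ ∫ v in vs..V, g' v :=
        intervalIntegral.integral_mono_on hV (hf.mono hsub).norm.intervalIntegrable hg'i
          fun v hv => hle v hv.1
    _ ≤ 2 * C / δ * (r vs)⁻¹ := by
        have := hpos V hV
        have : 0 ≤ 2 * C / δ * (r V)⁻¹ := by positivity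
        linarith

/-- Integration by parts: the truncated flux `∫ r² ψ'` together with its boundary term. -/
theorem integral_sq_mul_deriv_add {a b : ℝ} (hab : a ≤ b) {r r' ψ ψ' : ℝ → ℝ}
    (hr : ∀ v ∈ Ici a, HasDerivWithinAt r (r' v) (Ici a) v)
    (hψ : ∀ v ∈ Ici a, HasDerivWithinAt ψ (ψ' v) (Ici a) v)
    (hr' : ContinuousOn r' (Ici a)) (hψ' : ContinuousOn ψ' (Ici a)) :
    (∫ v in a..b, r v ^ 2 * ψ' v) + r b ^ 2 * ψ b
      = r a ^ 2 * ψ a + ∫ v in a..b, 2 * r v * (r' v * ψ v + r v * ψ' v) := by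
  have hrc : ContinuousOn r (Ici a) := fun v hv => (hr v hv).continuousWithinAt
  have hψc : ContinuousOn ψ (Ici a) := fun v hv => (hψ v hv).continuousWithinAt
  have hsub : uIcc a b ⊆ Ici a := by
    rw [uIcc_of_le hab]
    exact Icc_subset_Ici_self
  have hi₁ : IntervalIntegrable (fun v => r v ^ 2 * ψ' v) volume a b :=
    (((hrc.pow 2).mul hψ').mono hsub).intervalIntegrable
  have hi₂ : IntervalIntegrable (fun v => 2 * r v * (r' v * ψ v + r v * ψ' v)) volume a b :=
    (((continuousOn_const.mul hrc).mul ((hr'.mul hψc).add (hrc.mul hψ'))).mono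
      hsub).intervalIntegrable
  have hFTC := intervalIntegral.integral_eq_sub_of_hasDerivAt_of_le
    (f := fun v => r v ^ 2 * ψ v)
    (f' := fun v => 2 * r v * (r' v * ψ v + r v * ψ' v) - r v ^ 2 * ψ' v) hab
    (((hrc.pow 2).mul hψc).mono Icc_subset_Ici_self)
    (fun v hv => by
      have h₁ := (hr v hv.1.le).hasDerivAt (Ici_mem_nhds hv.1)
      have h₂ := (hψ v hv.1.le).hasDerivAt (Ici_mem_nhds hv.1)
      refine ((h₁.pow 2).mul h₂).congr_deriv ?_
      simp only [Pi.pow_apply]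
      push_cast
      ring)
    (hi₂.sub hi₁)
  rw [intervalIntegral.integral_sub hi₂ hi₁] at hFTC
  linarith

/-- Outgoing null case of Lemma 3.1: if `r³|φ′|` is bounded
(`φ = rψ`), then `∫ 2 r φ′` converges absolutely on `[v*, ∞)` and
`lim_{V→∞} ( ∫_{v*}^V r² ψ′ + r(V)² ψ(V) )` exists, is finite, and equals
`r(v*)² ψ(v*) + ∫_{v*}^∞ 2 r φ′`. -/
theorem modified_gradient_flux_outgoing_null
    (M vs : ℝ) (hM : 0 < M)
    (D : ℝ → ℝ) (hD : ∀ ρ : ℝ, D ρ = 1 - 2 * M / ρ)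
    (r ψ ψd : ℝ → ℝ)
    (hr : ∀ v ∈ Set.Ici vs, 2 * M < r v)
    (hrd : ∀ v ∈ Set.Ici vs, HasDerivWithinAt r (D (r v) / 2) (Set.Ici vs) v)
    (hψd : ∀ v ∈ Set.Ici vs, HasDerivWithinAt ψ (ψd v) (Set.Ici vs) v)
    (hψcont : ContinuousOn ψ (Set.Ici vs)) (hψdcont : ContinuousOn ψd (Set.Ici vs))
    (φ φd : ℝ → ℝ) (hφ : φ = fun v => r v * ψ v)
    (hφd : ∀ v ∈ Set.Ici vs, HasDerivWithinAt φ (φd v) (Set.Ici vs) v)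
    (hφdcont : ContinuousOn φd (Set.Ici vs))
    (C : ℝ) (hbd : ∀ v ∈ Set.Ici vs, (r v) ^ 3 * |φd v| ≤ C) :
    MeasureTheory.IntegrableOn (fun v => 2 * r v * φd v) (Set.Ici vs) ∧
    ∃ G : ℝ,
      Tendsto (fun V => (∫ v in vs..V, (r v) ^ 2 * ψd v) + (r V) ^ 2 * ψ V)
        atTop (nhds G) ∧
      G = (r vs) ^ 2 * ψ vs + ∫ v in Set.Ici vs, 2 * r v * φd v := by
  obtain rfl : D = fun ρ => 1 - 2 * M / ρ := funext hD
  subst hφ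
  have hpos : ∀ v ∈ Ici vs, 0 < r v := fun v hv => by linarith [hr v hv]
  have hrc : ContinuousOn r (Ici vs) := fun v hv => (hrd v hv).continuousWithinAt
  have hr'c : ContinuousOn (fun v => (1 - 2 * M / r v) / 2) (Ici vs) :=
    (continuousOn_const.sub
      (continuousOn_const.div hrc fun v hv => (hpos v hv).ne')).div_const 2
  have hφeq : ∀ v ∈ Ici vs, φd v = (1 - 2 * M / r v) / 2 * ψ v + r v * ψd v := fun v hv =>
    (uniqueDiffOn_Ici vs v hv).eq_deriv _ (hφd v hv) ((hrd v hv).mul (hψd v hv))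
  have hint : IntegrableOn (fun v => 2 * r v * φd v) (Ioi vs) := by
    refine integrableOn_of_sq_areaRadius_mul_le hM hr hrd
      ((continuousOn_const.mul hrc).mul hφdcont) (C := 2 * C) fun v hv => ?_
    have h := hpos v hv
    rw [abs_mul, abs_of_pos (by positivity : 0 < 2 * r v)]
    linarith [hbd v hv]
  refine ⟨(integrableOn_Ici_iff_integrableOn_Ioi enorm_ne_top).2 hint, _, ?_, rfl⟩
  rw [integral_Ici_eq_integral_Ioi]
  refine ((intervalIntegral_tendsto_integral_Ioi vs hint tendsto_id).const_add
    (r vs ^ 2 * ψ vs)).congr' ?_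
  filter_upwards [eventually_ge_atTop vs] with V hV
  rw [integral_sq_mul_deriv_add hV hrd hψd hr'c hψdcont]
  congr 1
  refine intervalIntegral.integral_congr fun v hv => ?_
  rw [id, uIcc_of_le hV] at hv
  simp only [hφeq v hv.1]
end

section
/- Let M > 0, D(r) = 1 − 2M/r, let r be the Schwarzschild area-radius function on ℝ² (C¹ with values in (2M,∞), ∂_v r = D(r)/2, ∂_u r = −D(r)/2), and let ψ : ℝ² → ℝ be C¹ with φ = r·ψ. Let ε > 0, C > 0, v* > 0, let f : [v*, ∞) → [0, ∞) be continuous with f(v) ≤ C·v^{−1−ε}, and let U : [v*, ∞) → ℝ satisfy U′(v) = −f(v); set γ(v) = (U(v), v). Assume along the curve: v·|ψ(γ(v))| ≤ C, v^{1+ε}·f(v)·D(r(γ(v))) ≤ C, and v³·|∂_v φ(γ(v))| ≤ C for all v ≥ v*. Then lim_{V→∞} ( ∫_{v*}^{V} ( ∂_v ψ + f·∂_u ψ )(γ(v)) · r(γ(v))² dv + r(γ(V))²·ψ(γ(V)) ) exists, is finite, and equals r(γ(v*))²·ψ(γ(v*)) + ∫_{v*}^{∞} ( 2·r·∂_v φ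 + f·D(r)·r·ψ )(γ(v)) dv, this last improper integral converging absolutely. -/
open Filter Set MeasureTheory

/-- The `v`-partial derivative of a differentiable function of `(u, v)`. -/
theorem hasDerivAt_snd_of_differentiableAt {g : ℝ × ℝ → ℝ} {p : ℝ × ℝ}
    (hg : DifferentiableAt ℝ g p) :
    HasDerivAt (fun t => g (p.1, t)) (fderiv ℝ g p (0, 1)) p.2 :=
  hg.hasFDerivAt.comp_hasDerivAt_of_eq p.2
    ((hasDerivAt_const p.2 p.1).prodMk (hasDerivAt_id p.2)) rfl

/-- The `u`-partial derivative of a differentiable function of `(u, v)`. -/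
theorem hasDerivAt_fst_of_differentiableAt {g : ℝ × ℝ → ℝ} {p : ℝ × ℝ}
    (hg : DifferentiableAt ℝ g p) :
    HasDerivAt (fun s => g (s, p.2)) (fderiv ℝ g p (1, 0)) p.1 :=
  hg.hasFDerivAt.comp_hasDerivAt_of_eq p.1
    ((hasDerivAt_id p.1).prodMk (hasDerivAt_const p.1 p.2)) rfl

/-- Chain rule along a curve `v ↦ (U v, v)`: the tangential derivative is `∂_v + U′ ∂_u`. -/
theorem hasDerivWithinAt_along_graph {g : ℝ × ℝ → ℝ} {U : ℝ → ℝ} {U' v : ℝ} {s : Set ℝ}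
    (hg : DifferentiableAt ℝ g (U v, v)) (hU : HasDerivWithinAt U U' s v) :
    HasDerivWithinAt (fun x => g (U x, x))
      (fderiv ℝ g (U v, v) (0, 1) + U' * fderiv ℝ g (U v, v) (1, 0)) s v := by
  have h := hg.hasFDerivAt.comp_hasDerivWithinAt_of_eq v
    (hU.prodMk (hasDerivWithinAt_id v s)) rfl
  have hsplit : ((U', 1) : ℝ × ℝ) = (0, 1) + U' • (1, 0) := by simp
  rw [hsplit, map_add, map_smul, smul_eq_mul] at h
  exact h

/-- If `F' = k - j` on `[a, ∞)` with `k` integrable, then `∫ j + F` converges to `F a + ∫ k`. -/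
theorem tendsto_integral_add_of_hasDerivWithinAt {F j k : ℝ → ℝ} {a : ℝ}
    (hF : ∀ v ∈ Ici a, HasDerivWithinAt F (k v - j v) (Ici a) v)
    (hj : ContinuousOn j (Ici a)) (hk : ContinuousOn k (Ici a))
    (hkint : IntegrableOn k (Ici a)) :
    Tendsto (fun V => (∫ v in a..V, j v) + F V) atTop (nhds (F a + ∫ v in Ici a, k v)) := by
  have hlim := intervalIntegral_tendsto_integral_Ioi a
    (hkint.mono_set Ioi_subset_Ici_self) tendsto_id
  rw [integral_Ici_eq_integral_Ioi]
  refine (hlim.const_add (F a)).congr' ?_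
  filter_upwards [eventually_ge_atTop a] with V hV
  have hsub : uIcc a V ⊆ Ici a := by
    rw [uIcc_of_le hV]
    exact Icc_subset_Ici_self
  have hji := (hj.mono hsub).intervalIntegrable (μ := volume)
  have hki := (hk.mono hsub).intervalIntegrable (μ := volume)
  have hftc := intervalIntegral.integral_eq_sub_of_hasDeriv_right_of_le hV
    (fun x hx => ((hF x hx.1).continuousWithinAt).mono Icc_subset_Ici_self)
    (fun x hx => (hF x hx.1.le).mono
      (Ioi_subset_Ici_self.trans (Ici_subset_Ici.2 hx.1.le))) (hki.sub hji)
  rw [intervalIntegral.integral_sub hki hji] at hftc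
  simp only [id]
  linarith

/-- A function on `[a, ∞)`, `a > 0`, with derivative bounded above grows at most linearly. -/
theorem exists_le_mul_of_hasDerivWithinAt_le {R R' : ℝ → ℝ} {a B : ℝ} (ha : 0 < a) (hB : 0 ≤ B)
    (hR : ∀ v ∈ Ici a, HasDerivWithinAt R (R' v) (Ici a) v) (hbd : ∀ v ∈ Ici a, R' v ≤ B) :
    ∃ K, 0 < K ∧ ∀ v ∈ Ici a, R v ≤ K * v := by
  refine ⟨|R a| / a + B + 1, by positivity, fun v hv => ?_⟩
  have hav : a ≤ v := hv
  have hle : R v ≤ R a + B * (v - a) := by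
    refine image_le_of_deriv_right_le_deriv_boundary (f := R) (f' := R') (a := a) (b := v)
      (B := fun x => R a + B * (x - a)) (B' := fun _ => B)
      (fun x hx => ((hR x hx.1).continuousWithinAt).mono Icc_subset_Ici_self)
      (fun x hx => (hR x hx.1).mono (Ici_subset_Ici.2 hx.1)) (by simp) (by fun_prop)
      (fun x _ => ?_) (fun x hx => hbd x hx.1) ⟨hav, le_rfl⟩
    simpa using ((((hasDerivAt_id x).sub_const a).const_mul B).const_add (R a)).hasDerivWithinAt
  have h1 : |R a| ≤ |R a| / a * v := by
    rw [div_mul_eq_mul_div, le_div_iff₀ ha]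
    gcongr
  nlinarith [le_abs_self (R a), mul_nonneg hB ha.le]

/-- Hyperboloidal case of Lemma 3.1: along a hyperboloidal curve
`γ(v) = (U(v), v)` with `U′ = −f`, `f(v) ≤ C v^{−1−ε}`, and the decay
hypotheses `v|ψ| ≤ C`, `v^{1+ε} f D(r) ≤ C`, `v³|∂_v φ| ≤ C` along the curve,
the modified gradient flux converges:
`lim_{V→∞} ( ∫_{v*}^V (∂_vψ + f ∂_uψ) r² dv + r²ψ(γ(V)) )` exists and equals
`r²ψ(γ(v*)) + ∫_{v*}^∞ (2 r ∂_vφ + f D(r) r ψ)(γ(v)) dv`, the latter integral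
converging absolutely. -/
theorem modified_gradient_flux_hyperboloidal
    (M : ℝ) (hM : 0 < M)
    (D : ℝ → ℝ) (hD : ∀ ρ : ℝ, D ρ = 1 - 2 * M / ρ)
    (r ψ : ℝ × ℝ → ℝ)
    (hr : ∀ p : ℝ × ℝ, 2 * M < r p)
    (hrC1 : ContDiff ℝ 1 r)
    (hru : ∀ p : ℝ × ℝ, HasDerivAt (fun u => r (u, p.2)) (-(D (r p)) / 2) p.1)
    (hrv : ∀ p : ℝ × ℝ, HasDerivAt (fun v => r (p.1, v)) (D (r p) / 2) p.2)
    (hψC1 : ContDiff ℝ 1 ψ)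
    (φ : ℝ × ℝ → ℝ) (hφ : φ = fun p => r p * ψ p)
    (ε C vs : ℝ) (hε : 0 < ε) (hC : 0 < C) (hvs : 0 < vs)
    (f : ℝ → ℝ) (hfcont : ContinuousOn f (Set.Ici vs))
    (hf0 : ∀ v ∈ Set.Ici vs, 0 ≤ f v)
    (hfbd : ∀ v ∈ Set.Ici vs, f v ≤ C * v ^ (-(1 : ℝ) - ε))
    (U : ℝ → ℝ) (hU : ∀ v ∈ Set.Ici vs, HasDerivWithinAt U (-(f v)) (Set.Ici vs) v)
    (γ : ℝ → ℝ × ℝ) (hγ : γ = fun v => ((U v, v) : ℝ × ℝ))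
    (hψbd : ∀ v ∈ Set.Ici vs, v * |ψ (γ v)| ≤ C)
    (hfDbd : ∀ v ∈ Set.Ici vs, v ^ ((1 : ℝ) + ε) * f v * D (r (γ v)) ≤ C)
    (hφvbd : ∀ v ∈ Set.Ici vs, v ^ 3 * |deriv (fun t => φ ((γ v).1, t)) v| ≤ C) :
    MeasureTheory.IntegrableOn
      (fun v => 2 * r (γ v) * deriv (fun t => φ ((γ v).1, t)) v
        + f v * D (r (γ v)) * r (γ v) * ψ (γ v)) (Set.Ici vs) ∧
    ∃ G : ℝ,
      Tendsto (fun V =>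
          (∫ v in vs..V,
            (deriv (fun t => ψ ((γ v).1, t)) v + f v * deriv (fun s => ψ (s, v)) (γ v).1)
              * (r (γ v)) ^ 2)
          + (r (γ V)) ^ 2 * ψ (γ V)) atTop (nhds G) ∧
      G = (r (γ vs)) ^ 2 * ψ (γ vs)
        + ∫ v in Set.Ici vs,
            (2 * r (γ v) * deriv (fun t => φ ((γ v).1, t)) v
              + f v * D (r (γ v)) * r (γ v) * ψ (γ v)) := by
  subst hγ hφ
  have hψd := hψC1.differentiable one_ne_zero
  have hrd := hrC1.differentiable one_ne_zero
  have hrpos : ∀ p, 0 < r p := fun p => by linarith [hr p]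
  have hDpos : ∀ p, 0 < D (r p) := fun p => by
    rw [hD, sub_pos, div_lt_one (hrpos p)]
    exact hr p
  have hDle : ∀ p, D (r p) ≤ 1 := fun p => by
    rw [hD]
    linarith [div_pos (mul_pos two_pos hM) (hrpos p)]
  have hUc : ContinuousOn U (Ici vs) := fun v hv => (hU v hv).continuousWithinAt
  have hγc : ContinuousOn (fun v => (U v, v)) (Ici vs) := hUc.prodMk continuousOn_id
  have hrc : ContinuousOn (fun v => r (U v, v)) (Ici vs) :=
    hrC1.continuous.comp_continuousOn hγc
  have hψc : ContinuousOn (fun v => ψ (U v, v)) (Ici vs) :=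
    hψC1.continuous.comp_continuousOn hγc
  have hDc : ContinuousOn (fun v => D (r (U v, v))) (Ici vs) := by
    simp only [hD]
    exact continuousOn_const.sub (continuousOn_const.div hrc fun v _ => (hrpos _).ne')
  have hψpc : ∀ w : ℝ × ℝ, ContinuousOn (fun v => fderiv ℝ ψ (U v, v) w) (Ici vs) := fun w =>
    ((hψC1.continuous_fderiv one_ne_zero).clm_apply continuous_const).comp_continuousOn hγc
  have hψv : ∀ v, deriv (fun t => ψ (U v, t)) v = fderiv ℝ ψ (U v, v) (0, 1) := fun v =>
    (hasDerivAt_snd_of_differentiableAt (hψd (U v, v))).deriv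
  have hψu : ∀ v, deriv (fun s => ψ (s, v)) (U v) = fderiv ℝ ψ (U v, v) (1, 0) := fun v =>
    (hasDerivAt_fst_of_differentiableAt (hψd (U v, v))).deriv
  have hφv : ∀ v, deriv (fun t => r (U v, t) * ψ (U v, t)) v =
      D (r (U v, v)) / 2 * ψ (U v, v) + r (U v, v) * fderiv ℝ ψ (U v, v) (0, 1) := fun v =>
    ((hrv (U v, v)).mul (hasDerivAt_snd_of_differentiableAt (hψd (U v, v)))).deriv
  have hrγ : ∀ v ∈ Ici vs, HasDerivWithinAt (fun x => r (U x, x))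
      (D (r (U v, v)) / 2 * (1 + f v)) (Ici vs) v := fun v hv => by
    refine (hasDerivWithinAt_along_graph (hrd (U v, v)) (hU v hv)).congr_deriv ?_
    rw [(hasDerivAt_snd_of_differentiableAt (hrd (U v, v))).unique (hrv (U v, v)),
      (hasDerivAt_fst_of_differentiableAt (hrd (U v, v))).unique (hru (U v, v))]
    ring
  have hfle : ∀ v ∈ Ici vs, f v ≤ C * vs ^ (-(1 : ℝ) - ε) := fun v hv =>
    (hfbd v hv).trans (mul_le_mul_of_nonneg_left
      (Real.rpow_le_rpow_of_nonpos hvs hv (by linarith)) hC.le)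
  obtain ⟨K, hK, hrK⟩ := exists_le_mul_of_hasDerivWithinAt_le
    (B := 1 + C * vs ^ (-(1 : ℝ) - ε)) hvs (by positivity) hrγ (fun v hv => by
      nlinarith [hDpos (U v, v), hDle (U v, v), hf0 v hv, hfle v hv])
  simp only [hψv, hψu, hφv] at hφvbd ⊢
  have hkc : ContinuousOn (fun v => 2 * r (U v, v) * (D (r (U v, v)) / 2 * ψ (U v, v)
      + r (U v, v) * fderiv ℝ ψ (U v, v) (0, 1))
      + f v * D (r (U v, v)) * r (U v, v) * ψ (U v, v)) (Ici vs) :=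
    ((continuousOn_const.mul hrc).mul
      (((hDc.div_const 2).mul hψc).add (hrc.mul (hψpc (0, 1))))).add
      (((hfcont.mul hDc).mul hrc).mul hψc)
  have hkint : IntegrableOn (fun v => 2 * r (U v, v) * (D (r (U v, v)) / 2 * ψ (U v, v)
      + r (U v, v) * fderiv ℝ ψ (U v, v) (0, 1))
      + f v * D (r (U v, v)) * r (U v, v) * ψ (U v, v)) (Ici vs) := by
    have hmaj : IntegrableOn (fun v : ℝ => 2 * K * C * v ^ (-2 : ℝ)
        + K * C * C * v ^ (-(1 : ℝ) - ε)) (Ici vs) := by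
      rw [integrableOn_Ici_iff_integrableOn_Ioi]
      exact ((integrableOn_Ioi_rpow_of_lt (by norm_num) hvs).const_mul _).add
        ((integrableOn_Ioi_rpow_of_lt (by linarith) hvs).const_mul _)
    refine Integrable.mono' hmaj (hkc.aestronglyMeasurable measurableSet_Ici) ?_
    filter_upwards [ae_restrict_mem measurableSet_Ici] with v hv
    have hv0 : 0 < v := hvs.trans_le hv
    have hφb := hφvbd v hv
    set X := D (r (U v, v)) / 2 * ψ (U v, v) + r (U v, v) * fderiv ℝ ψ (U v, v) (0, 1)
    have h1 : 2 * r (U v, v) * |X| ≤ 2 * K * C * v ^ (-2 : ℝ) := by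
      rw [Real.rpow_neg hv0.le, Real.rpow_two, ← div_eq_mul_inv, le_div_iff₀ (by positivity)]
      calc 2 * r (U v, v) * |X| * v ^ 2 ≤ 2 * (K * v) * |X| * v ^ 2 := by
            gcongr
            exact hrK v hv
        _ = 2 * K * (v ^ 3 * |X|) := by ring
        _ ≤ 2 * K * C := by gcongr
    have h2 : f v * D (r (U v, v)) * r (U v, v) * |ψ (U v, v)|
        ≤ K * C * C * v ^ (-(1 : ℝ) - ε) := by
      have hf := hf0 v hv
      calc f v * D (r (U v, v)) * r (U v, v) * |ψ (U v, v)|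
          ≤ f v * 1 * (K * v) * |ψ (U v, v)| := by
            gcongr
            · exact (hrpos _).le
            · exact hDle _
            · exact hrK v hv
        _ = f v * K * (v * |ψ (U v, v)|) := by ring
        _ ≤ (C * v ^ (-(1 : ℝ) - ε)) * K * C := by
            gcongr
            · exact hfbd v hv
            · exact hψbd v hv
        _ = _ := by ring
    refine (norm_add_le _ _).trans (add_le_add ?_ ?_)
    · rwa [Real.norm_eq_abs, abs_mul, abs_of_pos (mul_pos two_pos (hrpos _))]
    · rwa [Real.norm_eq_abs, abs_mul, abs_of_nonneg
        (mul_nonneg (mul_nonneg (hf0 v hv) (hDpos _).le) (hrpos _).le)]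
  refine ⟨hkint, _, tendsto_integral_add_of_hasDerivWithinAt
    (F := fun v => r (U v, v) ^ 2 * ψ (U v, v)) (fun v hv => ?_) ?_ hkc hkint, rfl⟩
  · refine (((hrγ v hv).pow 2).mul
      (hasDerivWithinAt_along_graph (hψd (U v, v)) (hU v hv))).congr_deriv ?_
    simp only [Pi.pow_apply]
    ring
  · exact ((hψpc (0, 1)).add (hfcont.mul (hψpc (1, 0)))).mul (hrc.pow 2)
end

section
/- Let M > 0, D(ρ) = 1 − 2M/ρ, R > 2M, and let h, ψ : [2M, R] → ℝ be C¹. Then ∫_{2M}^{R} ( −2ρ²ψ′(ρ) − 2ρψ(ρ) + ρ²·h(ρ)·D(ρ)·ψ′(ρ) ) dρ = −R²·D(R)·h(R)·ψ(R) + ∫_{2M}^{R} ( 2·(h(ρ)D(ρ) − 1)·ρ·(ρψ)′(ρ) + ρ²·(D·h)′(ρ)·ψ(ρ) ) dρ. -/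
open Filter Set

/-- Integration by parts on the spacelike piece `[2M, R]`:
`∫_{2M}^R (−2ρ²ψ′ − 2ρψ + ρ² h D ψ′) dρ
  = −R² D(R) h(R) ψ(R) + ∫_{2M}^R (2(hD − 1) ρ (ρψ)′ + ρ² (Dh)′ ψ) dρ`,
where `(ρψ)′ = ψ + ρψ′` and `(Dh)′ = (2M/ρ²) h + D h′`. -/
theorem spacelike_integration_by_parts
    (M R : ℝ) (hM : 0 < M) (hR : 2 * M < R)
    (D : ℝ → ℝ) (hD : ∀ ρ : ℝ, D ρ = 1 - 2 * M / ρ)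
    (h ψ hd ψd : ℝ → ℝ)
    (hh : ∀ ρ ∈ Set.Icc (2 * M) R, HasDerivWithinAt h (hd ρ) (Set.Icc (2 * M) R) ρ)
    (hψ : ∀ ρ ∈ Set.Icc (2 * M) R, HasDerivWithinAt ψ (ψd ρ) (Set.Icc (2 * M) R) ρ)
    (hhc : ContinuousOn h (Set.Icc (2 * M) R))
    (hψc : ContinuousOn ψ (Set.Icc (2 * M) R))
    (hhdc : ContinuousOn hd (Set.Icc (2 * M) R))
    (hψdc : ContinuousOn ψd (Set.Icc (2 * M) R)) :
    ∫ ρ in (2 * M)..R, (-2 * ρ ^ 2 * ψd ρ - 2 * ρ * ψ ρ + ρ ^ 2 * h ρ * D ρ * ψd ρ) =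
      -(R ^ 2 * D R * h R * ψ R)
      + ∫ ρ in (2 * M)..R,
          (2 * (h ρ * D ρ - 1) * ρ * (ψ ρ + ρ * ψd ρ)
            + ρ ^ 2 * ((2 * M / ρ ^ 2) * h ρ + D ρ * hd ρ) * ψ ρ) := by
  have hle : 2 * M ≤ R := hR.le
  have hne : ∀ ρ ∈ Icc (2 * M) R, ρ ≠ 0 := fun ρ hρ => by linarith [hρ.1]
  obtain rfl : D = fun ρ => 1 - 2 * M / ρ := funext hD
  have hDc : ContinuousOn (fun ρ : ℝ => 1 - 2 * M / ρ) (Icc (2 * M) R) :=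
    continuousOn_const.sub (continuousOn_const.div continuousOn_id hne)
  have hDdc : ContinuousOn (fun ρ : ℝ => 2 * M / ρ ^ 2) (Icc (2 * M) R) :=
    continuousOn_const.div (continuousOn_id.pow 2) fun ρ hρ => pow_ne_zero 2 (hne ρ hρ)
  have hLHS : IntervalIntegrable
      (fun ρ => -2 * ρ ^ 2 * ψd ρ - 2 * ρ * ψ ρ + ρ ^ 2 * h ρ * (1 - 2 * M / ρ) * ψd ρ)
      MeasureTheory.volume (2 * M) R :=
    ContinuousOn.intervalIntegrable_of_Icc hle (by fun_prop)
  have hRHS : IntervalIntegrable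
      (fun ρ => 2 * (h ρ * (1 - 2 * M / ρ) - 1) * ρ * (ψ ρ + ρ * ψd ρ)
        + ρ ^ 2 * ((2 * M / ρ ^ 2) * h ρ + (1 - 2 * M / ρ) * hd ρ) * ψ ρ)
      MeasureTheory.volume (2 * M) R :=
    ContinuousOn.intervalIntegrable_of_Icc hle (by fun_prop)
  have key := intervalIntegral.integral_eq_sub_of_hasDerivAt_of_le hle
    (f := fun ρ => ρ ^ 2 * (1 - 2 * M / ρ) * h ρ * ψ ρ) (by fun_prop)
    (fun ρ hρ => by
      have hmem := Icc_mem_nhds hρ.1 hρ.2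
      have hρ' := Ioo_subset_Icc_self hρ
      have h0 := hne ρ hρ'
      have hDd : HasDerivAt (fun ρ : ℝ => 1 - 2 * M / ρ) (2 * M / ρ ^ 2) ρ := by
        exact (((hasDerivAt_inv h0).const_mul (2 * M)).const_sub 1).congr_deriv (by ring)
      refine ((((hasDerivAt_pow 2 ρ).mul hDd).mul ((hh ρ hρ').hasDerivAt hmem)).mul
        ((hψ ρ hρ').hasDerivAt hmem)).congr_deriv ?_
      simp only [Pi.mul_apply]
      push_cast
      ring) (hRHS.sub hLHS)
  rw [intervalIntegral.integral_sub hRHS hLHS] at key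
  have hzero : 1 - 2 * M / (2 * M) = 0 := by
    rw [div_self (by positivity), sub_self]
  simp only [hzero, mul_zero, zero_mul, sub_zero] at key
  linarith
end

section
/- Let M > 0, D(ρ) = 1 − 2M/ρ, R > 2M, v_R ∈ ℝ. Let h, ψ_s : [2M, R] → ℝ be C¹ and ψ̇ : [2M, R] → ℝ continuous. Let r : [v_R, ∞) → (2M, ∞) solve r′(v) = D(r(v))/2 with r(v_R) = R, let φ : [v_R, ∞) → ℝ be C¹ with φ(v_R) = R·ψ_s(R), suppose sup_v r(v)³·|φ′(v)| < ∞ and that L := lim_{v→∞} r(v)³·φ′(v) exists, and set ψ_n = φ/r. Then the limit lim_{V→∞} ( ∫_{v_R}^{V} r² ψ_n′ dv + r(V)²·ψ_n(V) − (2/M)·r(V)³·φ′(V) ) exists, and the identity M·[ (2M)²·ψ_s(2M) + ∫_{2M}^{R} ( (hD − 1)·ρ²·ψ_s′ + (2 − hD)·h·ρ²·ψ̇ ) dρ + lim_{V→∞} ( ∫_{v_R}^{V} r² ψ_n′ dv + r(V)²ψ_n(V) − (2/M)·r(V)³φ′(V) ) ] = −2L + M·R²·(2 − D(R)h(R))·ψ_s(R)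 + 2M·∫_{v_R}^{∞} r·φ′ dv − M·∫_{2M}^{R} ( 2(1 − hD)·ρ·(ρψ_s)′ − (2 − Dh)·h·ρ²·ψ̇ − ρ²·(Dh)′·ψ_s ) dρ holds. -/
open Filter Set MeasureTheory

/-- The fundamental theorem of calculus for one-sided derivatives at the endpoints. -/
theorem integral_eq_sub_of_hasDerivWithinAt_Icc {f f' : ℝ → ℝ} {a b : ℝ} (hab : a ≤ b)
    (hf : ∀ x ∈ Icc a b, HasDerivWithinAt f (f' x) (Icc a b) x)
    (hf' : ContinuousOn f' (Icc a b)) :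
    ∫ x in a..b, f' x = f b - f a :=
  intervalIntegral.integral_eq_sub_of_hasDerivAt_of_le hab
    (fun x hx => (hf x hx).continuousWithinAt)
    (fun x hx => (hf x (Ioo_subset_Icc_self hx)).hasDerivAt (Icc_mem_nhds hx.1 hx.2))
    (hf'.intervalIntegrable_of_Icc hab)

/-- A function with derivative at least `c` on `[a, ∞)` grows at least linearly. -/
theorem add_mul_sub_le_of_le_hasDerivWithinAt_Ici {f f' : ℝ → ℝ} {a c : ℝ}
    (hf : ∀ x ∈ Ici a, HasDerivWithinAt f (f' x) (Ici a) x)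
    (hc : ∀ x ∈ Ici a, c ≤ f' x) {x : ℝ} (hx : x ∈ Ici a) :
    f a + c * (x - a) ≤ f x := by
  have hderiv : ∀ y ∈ Ioi a, HasDerivAt f (f' y) y := fun y hy =>
    (hf y (mem_Ici.2 (mem_Ioi.1 hy).le)).hasDerivAt (Ici_mem_nhds hy)
  have key := (convex_Ici a).mul_sub_le_image_sub_of_le_deriv (C := c)
    (fun y hy => (hf y hy).continuousWithinAt)
    (fun y hy => (hderiv y (interior_Ici (a := a) ▸ hy)).differentiableAt.differentiableWithinAt)
    (fun y hy => by
      rw [interior_Ici] at hy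
      rw [(hderiv y hy).deriv]
      exact hc y (mem_Ici.2 (mem_Ioi.1 hy).le))
    a self_mem_Ici x hx hx
  linarith

/-- The inverse square of a positive function growing linearly is integrable at infinity. -/
theorem integrableOn_Ioi_inv_sq_affine {a b c : ℝ} (hb : 0 < b) (hc : 0 < c) :
    IntegrableOn (fun x => ((b + c * (x - a)) ^ 2)⁻¹) (Ioi a) := by
  have hpos : ∀ x ∈ Ici a, 0 < b + c * (x - a) := fun x hx => by
    have := mul_nonneg hc.le (sub_nonneg.2 (mem_Ici.1 hx))
    linarith
  have hderiv : ∀ x ∈ Ici a,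
      HasDerivAt (fun y => -(c * (b + c * (y - a)))⁻¹) ((b + c * (x - a)) ^ 2)⁻¹ x := by
    intro x hx
    have h0 := (hpos x hx).ne'
    have h1 : HasDerivAt (fun y => c * (b + c * (y - a))) (c * (c * 1)) x :=
      ((((hasDerivAt_id x).sub_const a).const_mul c).const_add b).const_mul c
    refine (h1.fun_inv (mul_ne_zero hc.ne' h0)).neg.congr_deriv ?_
    field_simp
  have hlim : Tendsto (fun y => -(c * (b + c * (y - a)))⁻¹) atTop (nhds (-0)) := by
    refine (Tendsto.inv_tendsto_atTop ?_).neg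
    exact (tendsto_atTop_add_const_left _ b
      ((tendsto_atTop_add_const_right _ (-a) tendsto_id).const_mul_atTop hc)).const_mul_atTop hc
  exact integrableOn_Ioi_deriv_of_nonneg' hderiv
    (fun x hx => by have := hpos x (mem_Ici.2 (mem_Ioi.1 hx).le); positivity) hlim

/-- If `r` grows at least linearly and `r³ |g|` is bounded, then `r g` is integrable at infinity. -/
theorem integrableOn_Ioi_mul_of_cube_mul_abs_le {r g : ℝ → ℝ} {a b c C : ℝ}
    (hb : 0 < b) (hc : 0 < c) (hr : ∀ x ∈ Ici a, b + c * (x - a) ≤ r x)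
    (hcr : ContinuousOn r (Ici a)) (hcg : ContinuousOn g (Ici a))
    (hC : ∀ x ∈ Ici a, r x ^ 3 * |g x| ≤ C) :
    IntegrableOn (fun x => r x * g x) (Ioi a) := by
  refine ((integrableOn_Ioi_inv_sq_affine hb hc).const_mul C).mono'
    (((hcr.mul hcg).mono Ioi_subset_Ici_self).aestronglyMeasurable measurableSet_Ioi) ?_
  refine (ae_restrict_iff' measurableSet_Ioi).2 (Eventually.of_forall fun x hx => ?_)
  have hx' : x ∈ Ici a := Ioi_subset_Ici_self hx
  have hs : 0 < b + c * (x - a) := by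
    have := mul_nonneg hc.le (sub_nonneg.2 (mem_Ici.1 hx'))
    linarith
  have hrx : 0 < r x := hs.trans_le (hr x hx')
  have hsq : (b + c * (x - a)) ^ 2 ≤ r x ^ 2 := pow_le_pow_left₀ hs.le (hr x hx') 2
  rw [Real.norm_eq_abs, abs_mul, abs_of_pos hrx, ← div_eq_mul_inv, le_div_iff₀ (by positivity)]
  calc r x * |g x| * (b + c * (x - a)) ^ 2 ≤ r x * |g x| * r x ^ 2 := by gcongr
    _ = r x ^ 3 * |g x| := by ring
    _ ≤ C := hC x hx'

/-- The TINP constant as a modified gradient flux, spacelike-null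
reduction (Theorem 1.1 of the paper, per solid angle): the truncated flux along
the null piece converges to a limit `G`, and `M` times the total modified
gradient flux (horizon term + spacelike normal flux + `G`) equals the
time-inverted Newman–Penrose expression. -/
theorem TINP_as_modified_gradient_flux
    (M R vR : ℝ) (hM : 0 < M) (hR : 2 * M < R)
    (D : ℝ → ℝ) (hD : ∀ ρ : ℝ, D ρ = 1 - 2 * M / ρ)
    (h ψs hd ψsd ψdot : ℝ → ℝ)
    (hh : ∀ ρ ∈ Set.Icc (2 * M) R, HasDerivWithinAt h (hd ρ) (Set.Icc (2 * M) R) ρ)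
    (hψs : ∀ ρ ∈ Set.Icc (2 * M) R, HasDerivWithinAt ψs (ψsd ρ) (Set.Icc (2 * M) R) ρ)
    (hhc : ContinuousOn h (Set.Icc (2 * M) R))
    (hψsc : ContinuousOn ψs (Set.Icc (2 * M) R))
    (hhdc : ContinuousOn hd (Set.Icc (2 * M) R))
    (hψsdc : ContinuousOn ψsd (Set.Icc (2 * M) R))
    (hψdotc : ContinuousOn ψdot (Set.Icc (2 * M) R))
    (r : ℝ → ℝ)
    (hrval : ∀ v ∈ Set.Ici vR, 2 * M < r v)
    (hrd : ∀ v ∈ Set.Ici vR, HasDerivWithinAt r (D (r v) / 2) (Set.Ici vR) v)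
    (hrR : r vR = R)
    (φ φd : ℝ → ℝ)
    (hφR : φ vR = R * ψs R)
    (hφd : ∀ v ∈ Set.Ici vR, HasDerivWithinAt φ (φd v) (Set.Ici vR) v)
    (hφc : ContinuousOn φ (Set.Ici vR)) (hφdc : ContinuousOn φd (Set.Ici vR))
    (C : ℝ) (hbd : ∀ v ∈ Set.Ici vR, (r v) ^ 3 * |φd v| ≤ C)
    (L : ℝ) (hL : Tendsto (fun v => (r v) ^ 3 * φd v) atTop (nhds L))
    (ψn ψnd : ℝ → ℝ)
    (hψn : ψn = fun v => φ v / r v)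
    (hψnd : ψnd = fun v => φd v / r v - φ v * D (r v) / (2 * (r v) ^ 2)) :
    ∃ G : ℝ,
      Tendsto (fun V => (∫ v in vR..V, (r v) ^ 2 * ψnd v)
          + (r V) ^ 2 * ψn V - (2 / M) * (r V) ^ 3 * φd V) atTop (nhds G) ∧
      M * ((2 * M) ^ 2 * ψs (2 * M)
          + (∫ ρ in (2 * M)..R, ((h ρ * D ρ - 1) * ρ ^ 2 * ψsd ρ
              + (2 - h ρ * D ρ) * h ρ * ρ ^ 2 * ψdot ρ))
          + G)
        = -2 * L + M * R ^ 2 * (2 - D R * h R) * ψs R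
          + 2 * M * (∫ v in Set.Ici vR, r v * φd v)
          - M * (∫ ρ in (2 * M)..R,
              (2 * (1 - h ρ * D ρ) * ρ * (ψs ρ + ρ * ψsd ρ)
                - (2 - D ρ * h ρ) * h ρ * ρ ^ 2 * ψdot ρ
                - ρ ^ 2 * ((2 * M / ρ ^ 2) * h ρ + D ρ * hd ρ) * ψs ρ)) := by
  obtain rfl : D = fun ρ => 1 - 2 * M / ρ := funext hD
  subst hψn hψnd
  have hR0 : 0 < R := by linarith
  have hrpos : ∀ v ∈ Ici vR, 0 < r v := fun v hv => by linarith [hrval v hv]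
  have hrc : ContinuousOn r (Ici vR) := fun v hv => (hrd v hv).continuousWithinAt
  have hRr : ∀ v ∈ Ici vR, R ≤ r v := fun v hv => by
    have := add_mul_sub_le_of_le_hasDerivWithinAt_Ici (c := 0) hrd (fun w hw => by
      have : 2 * M / r w ≤ 1 := (div_le_one (hrpos w hw)).2 (hrval w hw).le
      linarith) hv
    linarith
  have hc : 0 < (1 - 2 * M / R) / 2 := by
    have : 2 * M / R < 1 := (div_lt_one hR0).2 hR
    linarith
  have hlin : ∀ v ∈ Ici vR, R + (1 - 2 * M / R) / 2 * (v - vR) ≤ r v := fun v hv => by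
    rw [← hrR] at hRr ⊢
    refine add_mul_sub_le_of_le_hasDerivWithinAt_Ici hrd (fun w hw => ?_) hv
    have : 2 * M / r w ≤ 2 * M / r vR :=
      div_le_div_of_nonneg_left (by positivity) (hrR ▸ hR0) (hRr w hw)
    linarith
  have hint : IntegrableOn (fun v => r v * φd v) (Ioi vR) :=
    integrableOn_Ioi_mul_of_cube_mul_abs_le hR0 hc hlin hrc hφdc hbd
  have hnull : ∀ V ∈ Ici vR,
      (∫ v in vR..V, (r v) ^ 2 * (φd v / r v - φ v * (1 - 2 * M / r v) / (2 * (r v) ^ 2)))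
        + (r V) ^ 2 * (φ V / r V)
      = 2 * (∫ v in vR..V, r v * φd v) + R ^ 2 * ψs R := by
    intro V hV
    have hsub : Icc vR V ⊆ Ici vR := Icc_subset_Ici_self
    have hDc : ContinuousOn (fun v => (1 - 2 * M / r v) / 2) (Ici vR) :=
      (continuousOn_const.sub
        (continuousOn_const.div hrc fun v hv => (hrpos v hv).ne')).div_const 2
    have hc1 : ContinuousOn (fun v => r v * φd v) (Icc vR V) := (hrc.mul hφdc).mono hsub
    have hc2 : ContinuousOn (fun v => (1 - 2 * M / r v) / 2 * φ v + r v * φd v) (Icc vR V) :=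
      ((hDc.mul hφc).mono hsub).add hc1
    have hftc := integral_eq_sub_of_hasDerivWithinAt_Icc (f := fun v => r v * φ v) hV
      (fun v hv => ((hrd v (hsub hv)).fun_mul (hφd v (hsub hv))).mono hsub) hc2
    have hcongr :
        (∫ v in vR..V, (r v) ^ 2 * (φd v / r v - φ v * (1 - 2 * M / r v) / (2 * (r v) ^ 2)))
        = ∫ v in vR..V,
          (2 * (r v * φd v) - ((1 - 2 * M / r v) / 2 * φ v + r v * φd v)) := by
      refine intervalIntegral.integral_congr fun v hv => ?_
      rw [uIcc_of_le hV] at hv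
      have := (hrpos v (hsub hv)).ne'
      field_simp
      ring
    rw [hcongr, intervalIntegral.integral_sub
      ((hc1.intervalIntegrable_of_Icc hV).const_mul 2) (hc2.intervalIntegrable_of_Icc hV), hftc,
      intervalIntegral.integral_const_mul, hφR, hrR]
    have := (hrpos V hV).ne'
    field_simp
    ring
  refine ⟨2 * (∫ v in Ioi vR, r v * φd v) + R ^ 2 * ψs R - 2 / M * L, ?_, ?_⟩
  · have hI := intervalIntegral_tendsto_integral_Ioi vR hint tendsto_id
    refine (((hI.const_mul 2).add_const (R ^ 2 * ψs R)).sub (hL.const_mul (2 / M))).congr' ?_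
    filter_upwards [eventually_ge_atTop vR] with V hV
    rw [hnull V hV, id, mul_assoc]
  have hpos : ∀ ρ ∈ Icc (2 * M) R, ρ ≠ 0 := fun ρ hρ => by
    have := hρ.1
    exact (by linarith : (0 : ℝ) < ρ).ne'
  have hDc : ContinuousOn (fun ρ => 1 - 2 * M / ρ) (Icc (2 * M) R) :=
    continuousOn_const.sub (continuousOn_const.div continuousOn_id hpos)
  have hD'c : ContinuousOn (fun ρ => 2 * M / ρ ^ 2) (Icc (2 * M) R) :=
    continuousOn_const.div (continuousOn_id.pow 2) fun ρ hρ => pow_ne_zero 2 (hpos ρ hρ)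
  have hDd : ∀ ρ ∈ Icc (2 * M) R,
      HasDerivWithinAt (fun ρ => 1 - 2 * M / ρ) (2 * M / ρ ^ 2) (Icc (2 * M) R) ρ := by
    intro ρ hρ
    have hd1 := (((hasDerivAt_inv (hpos ρ hρ)).const_mul (2 * M)).const_sub 1).hasDerivWithinAt
      (s := Icc (2 * M) R)
    simpa [div_eq_mul_inv] using hd1
  have hc1 : ContinuousOn (fun ρ => (h ρ * (1 - 2 * M / ρ) - 1) * ρ ^ 2 * ψsd ρ
      + (2 - h ρ * (1 - 2 * M / ρ)) * h ρ * ρ ^ 2 * ψdot ρ) (Icc (2 * M) R) := by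
    fun_prop
  have hc2 : ContinuousOn (fun ρ =>
      2 * (1 - h ρ * (1 - 2 * M / ρ)) * ρ * (ψs ρ + ρ * ψsd ρ)
        - (2 - (1 - 2 * M / ρ) * h ρ) * h ρ * ρ ^ 2 * ψdot ρ
        - ρ ^ 2 * ((2 * M / ρ ^ 2) * h ρ + (1 - 2 * M / ρ) * hd ρ) * ψs ρ)
      (Icc (2 * M) R) := by
    fun_prop
  have hftc := integral_eq_sub_of_hasDerivWithinAt_Icc
    (f := fun ρ => ρ ^ 2 * (1 - (1 - 2 * M / ρ) * h ρ) * ψs ρ) hR.le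
    (fun ρ hρ => ((((hasDerivAt_pow 2 ρ).hasDerivWithinAt.fun_mul
      (((hDd ρ hρ).fun_mul (hh ρ hρ)).const_sub 1)).fun_mul (hψs ρ hρ)).congr_deriv
        (by simp only [Pi.add_apply]; push_cast; ring))) (hc1.add hc2)
  simp only [Pi.add_apply] at hftc
  rw [intervalIntegral.integral_add (hc1.intervalIntegrable_of_Icc hR.le)
    (hc2.intervalIntegrable_of_Icc hR.le), div_self (by positivity)] at hftc
  rw [integral_Ici_eq_integral_Ioi]
  have hML : M * (2 / M * L) = 2 * L := by field_simp
  linear_combination M * hftc - hML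
end
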